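/- Let f ∈ ℤ[x] be a squarefree polynomial of degree at least 3. Then the set {n ∈ ℤ : f(n) is a perfect square} is finite. -/

import Mathlib

open Polynomial

section

open Finset

/-- The product of the differences of a node with the other nodes of `0, …, r`. -/
theorem prod_range_erase_sub {r i : ℕ} (hi : i ∈ range (r + 1)) :
    ∏ k ∈ (range (r + 1)).erase i, ((i : ℚ) - k) =
      (-1) ^ (r - i) * (i.factorial * (r - i).factorial) := by
  obtain ⟨t, rfl⟩ : ∃ t, r = i + t := Nat.exists_eq_add_of_le (by simpa [Nat.lt_succ_iff] using hi)
  have h : ∏ k ∈ (range (i + t + 1)).erase i, ((i : ℚ) - k) =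
      ∏ k ∈ range (i + t + 1), if k = i then 1 else ((i : ℚ) - k) := by
    rw [← mul_prod_erase _ _ hi, if_pos rfl, one_mul]
    exact prod_congr rfl fun k hk => by rw [if_neg (ne_of_mem_erase hk)]
  rw [h, show i + t + 1 = i + (1 + t) by ring, prod_range_add, prod_range_add]
  have h1 : ∏ k ∈ range i, (if k = i then (1 : ℚ) else ((i : ℚ) - k)) = i.factorial := by
    rw [← prod_range_reflect, ← prod_range_add_one_eq_factorial]
    push_cast
    refine prod_congr rfl fun k hk => ?_
    have hk := mem_range.1 hk
    rw [if_neg (by omega), Nat.cast_sub (by omega), Nat.cast_sub (by omega)]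
    push_cast; ring
  have h2 : ∏ k ∈ range t, (if i + (1 + k) = i then (1 : ℚ) else ((i : ℚ) - (i + (1 + k) : ℕ))) =
      (-1) ^ t * t.factorial := by
    rw [← prod_range_add_one_eq_factorial]
    push_cast
    rw [show ((-1 : ℚ)) ^ t = ∏ _k ∈ range t, (-1 : ℚ) by simp, ← prod_mul_distrib]
    refine prod_congr rfl fun k hk => ?_
    rw [if_neg (by omega)]
    ring
  rw [h1, h2]
  simp
  ring

theorem factorial_div_prod_range_erase_sub {r i : ℕ} (hi : i ∈ range (r + 1)) :
    (r.factorial : ℚ) / ∏ k ∈ (range (r + 1)).erase i, ((i : ℚ) - k) =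
      (((-1) ^ (r - i) * (r.choose i : ℤ) : ℤ) : ℚ) := by
  have hir : i ≤ r := by simpa [Nat.lt_succ_iff] using hi
  rw [prod_range_erase_sub hi, div_eq_iff (by positivity),
    ← Nat.choose_mul_factorial_mul_factorial hir]
  push_cast
  have : ((-1 : ℚ) ^ (r - i)) * (-1) ^ (r - i) = 1 := by rw [← mul_pow]; simp
  linear_combination (-(r.choose i * i.factorial * (r - i).factorial : ℚ)) * this

theorem prod_range_erase_mul_sub (n : ℕ) {r i : ℕ} (hi : i ∈ range (r + 1)) :
    ∏ k ∈ (range (r + 1)).erase i, ((n * i : ℚ) - n * k) =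
      n ^ r * ∏ k ∈ (range (r + 1)).erase i, ((i : ℚ) - k) := by
  have : #((range (r + 1)).erase i) = r := by simp [card_erase_of_mem hi]
  simp_rw [← mul_sub]
  rw [prod_mul_distrib, prod_const, this]

theorem one_le_abs_intCast {q : ℤ} (hq : q ≠ 0) : 1 ≤ |(q : ℚ)| := by
  exact_mod_cast Int.one_le_abs hq

theorem exists_int_factorial_mul_div_prod {n r i : ℕ} {b : ℤ} (hi : i ∈ range (r + 1)) (hb : b ≠ 0)
    (hbn : |b| < n) :
    ∃ m : ℤ, (n ^ r * r.factorial * Nat.lcmUpto (n * (r + 1)) : ℚ) /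
        ∏ k ∈ range (r + 1), ((n * i + b : ℚ) - n * k) = m ∧
      |(m : ℚ)| ≤ n ^ r * Nat.lcmUpto (n * (r + 1)) * 2 ^ r := by
  set L := Nat.lcmUpto (n * (r + 1)) with hL
  have hn : 0 < n := by have := abs_nonneg b; omega
  have hir : i ≤ r := by simpa [Nat.lt_succ_iff] using hi
  have hz : ∀ k : ℕ, (n : ℤ) * i + b - n * k ≠ 0 := by
    intro k h
    apply hb
    apply Int.eq_zero_of_abs_lt_dvd (m := n) ⟨(k : ℤ) - i, by linear_combination h⟩ hbn
  have hzq : ∀ k : ℕ, (n * i + b : ℚ) - n * k ≠ 0 := fun k => by exact_mod_cast hz k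
  have hprod : (n ^ r * r.factorial * L : ℚ) / ∏ k ∈ range (r + 1), ((n * i + b : ℚ) - n * k) =
      ∑ k ∈ range (r + 1), (((-1) ^ (r - k) * (r.choose k : ℤ) : ℤ) : ℚ) *
        (L / ((n * i + b : ℚ) - n * k)) := by
    have hinj : Set.InjOn (fun k : ℕ => (n * k : ℚ)) (range (r + 1)) := by
      intro x _ y _ h
      have hn' : (n : ℚ) ≠ 0 := by positivity
      exact_mod_cast mul_left_cancel₀ hn' h
    have key := Lagrange.eval_interpolate_not_at_node (s := range (r + 1))
      (v := fun k : ℕ => (n * k : ℚ)) 1 (x := (n * i + b : ℚ)) fun k _ => sub_ne_zero.1 (hzq k)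
    rw [Lagrange.interpolate_one hinj (by simp), eval_one, Lagrange.eval_nodal] at key
    rw [div_eq_iff (prod_ne_zero_iff.2 fun k _ => hzq k)]
    rw [← mul_one (n ^ r * r.factorial * L : ℚ), key, mul_left_comm, mul_comm (∑ k ∈ _, _)]
    congr 1
    rw [mul_sum]
    refine sum_congr rfl fun k hk => ?_
    rw [← factorial_div_prod_range_erase_sub hk, Lagrange.nodalWeight, prod_inv_distrib,
      prod_range_erase_mul_sub n hk]
    have h1 : ∏ l ∈ (range (r + 1)).erase k, ((k : ℚ) - l) ≠ 0 := by
      rw [prod_range_erase_sub hk]; positivity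
    have := hzq k
    simp only [Pi.one_apply]
    field_simp
  have hintegral : ∀ k ∈ range (r + 1), ∃ q : ℤ, (L / ((n * i + b : ℚ) - n * k)) = q := by
    intro k hk
    have hk : k ≤ r := by simpa [Nat.lt_succ_iff] using hk
    have hdvd : ((n : ℤ) * i + b - n * k) ∣ L := by
      have h1 : |(n : ℤ) * i + b - n * k| ≤ n * (r + 1) := by
        rw [abs_lt] at hbn
        rw [abs_le]
        constructor <;> nlinarith
      have h2 : ((n : ℤ) * i + b - n * k).natAbs ≤ n * (r + 1) := by
        zify
        exact h1
      rw [← Int.natAbs_dvd, Int.natCast_dvd_natCast]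
      exact Finset.dvd_lcm (f := id) (Finset.mem_Icc.2 ⟨Int.natAbs_pos.2 (hz k), h2⟩)
    obtain ⟨q, hq⟩ := hdvd
    refine ⟨q, ?_⟩
    rw [div_eq_iff (hzq k)]
    have : ((L : ℤ) : ℚ) = (((n : ℤ) * i + b - n * k) * q : ℤ) := by rw [hq]
    push_cast at this
    linear_combination this
  choose! q hq using hintegral
  have hlow : (i.factorial * (r - i).factorial : ℚ) ≤
      |∏ k ∈ range (r + 1), ((n * i + b : ℚ) - n * k)| := by
    rw [abs_prod, ← mul_prod_erase _ _ hi]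
    have h0 : 1 ≤ |(n * i + b : ℚ) - n * i| := by
      simpa using one_le_abs_intCast hb
    have h1 : (i.factorial * (r - i).factorial : ℚ) =
        ∏ k ∈ (range (r + 1)).erase i, |(i : ℚ) - k| := by
      rw [← abs_prod, prod_range_erase_sub hi, abs_mul, abs_pow]
      simp
    rw [h1]
    refine le_trans ?_ (le_mul_of_one_le_left (prod_nonneg fun _ _ => abs_nonneg _) h0)
    refine prod_le_prod (fun _ _ => abs_nonneg _) fun k hk => ?_
    have hki : (i : ℤ) - k ≠ 0 := by
      have := ne_of_mem_erase hk
      omega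
    have h2 : |(i : ℤ) - k| ≤ |(n : ℤ) * i + b - n * k| := by
      have e : (n : ℤ) * i + b - n * k = n * (i - k) + b := by ring
      have h3 : |(n : ℤ) * (i - k)| - |b| ≤ |(n : ℤ) * i + b - n * k| := by
        rw [e]
        have := abs_sub_abs_le_abs_sub ((n : ℤ) * (i - k)) (-b)
        simpa using this
      rw [abs_mul, Nat.abs_cast] at h3
      have h4 := Int.one_le_abs hki
      nlinarith [mul_nonneg (sub_nonneg.2 h4) (sub_nonneg.2 (Nat.one_le_cast (α := ℤ).2 hn))]
    exact_mod_cast h2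
  refine ⟨∑ k ∈ range (r + 1), ((-1) ^ (r - k) * (r.choose k : ℤ)) * q k, ?_, ?_⟩
  · rw [hprod]
    push_cast
    refine sum_congr rfl fun k hk => ?_
    rw [hq k hk]
  · have : (((∑ k ∈ range (r + 1), ((-1) ^ (r - k) * (r.choose k : ℤ)) * q k : ℤ)) : ℚ) =
        (n ^ r * r.factorial * L : ℚ) / ∏ k ∈ range (r + 1), ((n * i + b : ℚ) - n * k) := by
      rw [hprod]
      push_cast
      refine sum_congr rfl fun k hk => ?_
      rw [hq k hk]
    rw [this, abs_div, abs_of_nonneg (by positivity : (0 : ℚ) ≤ n ^ r * r.factorial * L)]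
    have hpos : (0 : ℚ) < i.factorial * (r - i).factorial := by positivity
    rw [div_le_iff₀ (hpos.trans_le hlow)]
    have hch : (r.factorial : ℚ) = r.choose i * i.factorial * (r - i).factorial := by
      exact_mod_cast (Nat.choose_mul_factorial_mul_factorial hir).symm
    have hch2 : (r.choose i : ℚ) ≤ 2 ^ r := by exact_mod_cast Nat.choose_le_two_pow r i
    calc (n ^ r * r.factorial * L : ℚ)
        = (n ^ r * L) * r.choose i * (i.factorial * (r - i).factorial) := by rw [hch]; ring
      _ ≤ (n ^ r * L) * 2 ^ r * |∏ k ∈ range (r + 1), ((n * i + b : ℚ) - n * k)| := by gcongr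

theorem exists_lcmUpto_le_pow (n : ℕ) :
    ∃ E : ℕ, ∀ r, 1 ≤ r → Nat.lcmUpto (n * (r + 1)) ≤ E ^ r := by
  refine ⟨⌈Real.exp ((Real.log 4 + 4) * (2 * n))⌉₊, fun r hr => ?_⟩
  have h1 : (0 : ℝ) < Nat.lcmUpto (n * (r + 1)) := by exact_mod_cast Nat.lcmUpto_pos _
  have h2 : Real.log (Nat.lcmUpto (n * (r + 1))) ≤ (Real.log 4 + 4) * (n * (r + 1) : ℕ) := by
    rw [← Chebyshev.psi_eq_log_lcmUpto]
    exact Chebyshev.psi_le_const_mul_self (by positivity)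
  have h3 : (0 : ℝ) ≤ Real.log 4 := Real.log_nonneg (by norm_num)
  have hr' : (1 : ℝ) ≤ r := by exact_mod_cast hr
  have h4 : (Real.log 4 + 4) * ((n * (r + 1) : ℕ) : ℝ) ≤
      (r : ℝ) * ((Real.log 4 + 4) * (2 * n)) := by
    push_cast
    have : (0 : ℝ) ≤ (Real.log 4 + 4) * n := by positivity
    nlinarith
  have h5 := (Real.log_le_iff_le_exp h1).1 (h2.trans h4)
  rw [Real.exp_nat_mul] at h5
  have h6 := h5.trans (pow_le_pow_left₀ (Real.exp_pos _).le (Nat.le_ceil _) r)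
  exact_mod_cast h6

theorem prod_erase_product {r s i j : ℕ} (hi : i ∈ range (r + 1)) (hj : j ∈ range (s + 1))
    (F : ℕ × ℕ → ℚ) :
    ∏ p ∈ (range (r + 1) ×ˢ range (s + 1)).erase (i, j), F p =
      (∏ k ∈ (range (r + 1)).erase i, F (k, j)) *
        ∏ l ∈ (range (s + 1)).erase j, ∏ k ∈ range (r + 1), F (k, l) := by
  have hij : (i, j) ∈ range (r + 1) ×ˢ range (s + 1) := mem_product.2 ⟨hi, hj⟩
  have h : ∏ p ∈ (range (r + 1) ×ˢ range (s + 1)).erase (i, j), F p =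
      ∏ p ∈ range (r + 1) ×ˢ range (s + 1), if p = (i, j) then 1 else F p := by
    rw [← mul_prod_erase _ _ hij, if_pos rfl, one_mul]
    exact prod_congr rfl fun k hk => by rw [if_neg (ne_of_mem_erase hk)]
  rw [h, prod_product_right, ← mul_prod_erase _ _ hj]
  congr 1
  · rw [← mul_prod_erase _ _ hi, if_pos rfl, one_mul]
    exact prod_congr rfl fun k hk => by
      rw [if_neg (by simpa using ne_of_mem_erase hk)]
  · refine prod_congr rfl fun l hl => prod_congr rfl fun k _ => ?_
    rw [if_neg (by simpa using fun _ => ne_of_mem_erase hl)]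

/-- Integral coefficients, of exponential size, of a combination of the monomials `X ^ (n i + j)`
with `i ≤ r` and `j ≤ s` vanishing at `1` to the highest possible order. -/
theorem exists_pade_coeff {n s : ℕ} (hsn : s < n) :
    ∃ C : ℕ, ∀ r, 1 ≤ r → ∃ a : ℕ → ℕ → ℤ,
      (∀ i ∈ range (r + 1), ∀ j ∈ range (s + 1), a i j ≠ 0 ∧ |a i j| ≤ C ^ r) ∧
      ∀ P : ℚ[X], P.natDegree < (s + 1) * (r + 1) - 1 →
        ∑ i ∈ range (r + 1), ∑ j ∈ range (s + 1), (a i j : ℚ) * P.eval (n * i + j : ℚ) = 0 := by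
  obtain ⟨E, hE⟩ := exists_lcmUpto_le_pow n
  refine ⟨2 * (n * E * 2) ^ s, fun r hr => ?_⟩
  have hn : 0 < n := by omega
  set L := Nat.lcmUpto (n * (r + 1)) with hL
  have hLpos : 0 < L := Nat.lcmUpto_pos _
  set S := range (r + 1) ×ˢ range (s + 1) with hS
  set v : ℕ × ℕ → ℚ := fun p => n * p.1 + p.2 with hv
  set w : ℕ × ℕ → ℚ := fun p => ∏ q ∈ S.erase p, (v p - v q) with hw
  set D : ℚ := (n ^ r * r.factorial) * (n ^ r * r.factorial * L) ^ s with hD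
  have hD0 : D ≠ 0 := by positivity
  have hinj : Set.InjOn v S := by
    rintro ⟨i, j⟩ hp ⟨k, l⟩ hq h
    simp only [hS, coe_product, Set.mem_prod, coe_range, Set.mem_Iio] at hp hq
    have h : n * i + j = n * k + l := by
      simp only [hv] at h
      exact_mod_cast h
    have h1 : j = l := by
      have := congrArg (· % n) h
      simpa [Nat.mul_add_mod, Nat.mod_eq_of_lt (show j < n by omega),
        Nat.mod_eq_of_lt (show l < n by omega)] using this
    subst h1
    have := Nat.eq_of_mul_eq_mul_left hn (Nat.add_right_cancel h)
    rw [this]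
  have hw0 : ∀ p ∈ S, w p ≠ 0 := by
    intro p hp
    refine prod_ne_zero_iff.2 fun q hq => sub_ne_zero.2 fun h => ?_
    exact ne_of_mem_erase hq (hinj hp (mem_of_mem_erase hq) h).symm
  have hintegral : ∀ i ∈ range (r + 1), ∀ j ∈ range (s + 1), ∃ m : ℤ, D / w (i, j) = m ∧
      |(m : ℚ)| ≤ ((2 * (n * E * 2) ^ s : ℕ) : ℚ) ^ r := by
    intro i hi j hj
    have hdiff : ∀ l ∈ (range (s + 1)).erase j, ∃ m : ℤ,
        (n ^ r * r.factorial * L : ℚ) /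
          ∏ k ∈ range (r + 1), (v (i, j) - v (k, l)) = m ∧ |(m : ℚ)| ≤ n ^ r * L * 2 ^ r := by
      intro l hl
      have hlj := ne_of_mem_erase hl
      have hl := mem_range.1 (mem_of_mem_erase hl)
      have hj := mem_range.1 hj
      obtain ⟨m, hm, hm'⟩ := exists_int_factorial_mul_div_prod (n := n) (b := (j : ℤ) - l) hi
        (by omega) (by rw [abs_lt]; omega)
      refine ⟨m, ?_, hm'⟩
      rw [← hm]
      congr 1
      refine prod_congr rfl fun k _ => ?_
      simp only [hv]; push_cast; ring
    choose! m hm hm' using hdiff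
    have hcard : #((range (s + 1)).erase j) = s := by simp [card_erase_of_mem hj]
    have hval : D / w (i, j) = (((-1) ^ (r - i) * (r.choose i : ℤ) : ℤ) : ℚ) *
        ∏ l ∈ (range (s + 1)).erase j, (m l : ℚ) := by
      rw [← factorial_div_prod_range_erase_sub hi, ← prod_congr rfl hm, prod_div_distrib,
        prod_const, hcard, div_mul_div_comm]
      have : w (i, j) = (n ^ r * ∏ k ∈ (range (r + 1)).erase i, ((i : ℚ) - k)) *
          ∏ l ∈ (range (s + 1)).erase j, ∏ k ∈ range (r + 1), (v (i, j) - v (k, l)) := by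
        rw [hw, ← prod_range_erase_mul_sub n hi]
        simp only [hS]
        rw [prod_erase_product hi hj]
        congr 1
        refine prod_congr rfl fun k _ => ?_
        simp only [hv]; ring
      rw [this, hD]
      have hnq : (n : ℚ) ≠ 0 := by positivity
      rw [mul_assoc ((n : ℚ) ^ r) (r.factorial : ℚ), mul_assoc ((n : ℚ) ^ r) (∏ k ∈ _, _),
        mul_div_mul_left _ _ (pow_ne_zero _ hnq)]
    refine ⟨((-1) ^ (r - i) * (r.choose i : ℤ)) * ∏ l ∈ (range (s + 1)).erase j, m l, ?_, ?_⟩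
    · rw [hval]; push_cast; rfl
    · have h1 : |∏ l ∈ (range (s + 1)).erase j, (m l : ℚ)| ≤ (n ^ r * L * 2 ^ r) ^ s := by
        rw [abs_prod]
        exact (prod_le_prod (fun _ _ => abs_nonneg _) hm').trans_eq (by rw [prod_const, hcard])
      have h2 : (r.choose i : ℚ) ≤ 2 ^ r := by exact_mod_cast Nat.choose_le_two_pow r i
      have h3 : (L : ℚ) ≤ E ^ r := by exact_mod_cast hE r hr
      push_cast
      rw [abs_mul, abs_mul, abs_pow, abs_neg, abs_one, one_pow, one_mul, Nat.abs_cast]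
      calc (r.choose i : ℚ) * |∏ l ∈ (range (s + 1)).erase j, (m l : ℚ)|
          ≤ 2 ^ r * (n ^ r * L * 2 ^ r) ^ s := by gcongr
        _ ≤ 2 ^ r * (n ^ r * E ^ r * 2 ^ r) ^ s := by gcongr
        _ = _ := by rw [← mul_pow, ← mul_pow, ← pow_mul, mul_comm r s, pow_mul, ← mul_pow]
  choose! a ha ha' using hintegral
  refine ⟨a, fun i hi j hj => ⟨fun h0 => ?_, by exact_mod_cast ha' i hi j hj⟩, fun P hP => ?_⟩
  · have := ha i hi j hj
    rw [h0, Int.cast_zero] at this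
    exact div_ne_zero hD0 (hw0 _ (mem_product.2 ⟨hi, hj⟩)) this
  · have hcard : #S = (s + 1) * (r + 1) := by simp [hS, mul_comm]
    have h := Lagrange.coeff_eq_sum hinj (P := P) (by
      rw [hcard]
      refine (degree_le_natDegree).trans_lt ?_
      exact_mod_cast (by omega : P.natDegree < (s + 1) * (r + 1)))
    rw [hcard, coeff_eq_zero_of_natDegree_lt hP] at h
    rw [← sum_product', ← mul_zero D, h, mul_sum]
    refine sum_congr rfl fun p hp => ?_
    obtain ⟨hi, hj⟩ := mem_product.1 hp
    rw [← ha _ hi _ hj]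
    simp only [hw, hv]
    ring

theorem X_sub_one_pow_dvd_of_coeff_comp {Q : ℤ[X]} {T : ℕ}
    (h : ∀ l < T, (Q.comp (X + 1)).coeff l = 0) : (X - 1) ^ T ∣ Q := by
  obtain ⟨g, hg⟩ := X_pow_dvd_iff.2 h
  refine ⟨g.comp (X - 1), ?_⟩
  have := congrArg (fun p : ℤ[X] => p.comp (X - 1)) hg
  simpa [comp_assoc] using this

theorem sum_mul_pow_mul_choose_eq_zero {n s r : ℕ} {a : ℕ → ℕ → ℤ}
    (ha : ∀ P : ℚ[X], P.natDegree < (s + 1) * (r + 1) - 1 →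
      ∑ i ∈ range (r + 1), ∑ j ∈ range (s + 1), (a i j : ℚ) * P.eval (n * i + j : ℚ) = 0)
    {k l : ℕ} (hk : k ≤ s) (hl : l < (s + 1) * r) :
    ∑ i ∈ range (r + 1), ∑ j ∈ range (s + 1),
      a i j * (n * i + j : ℕ) ^ k * ((n * i + j).choose l : ℤ) = 0 := by
  have hdeg : (X ^ k * descPochhammer ℚ l).natDegree < (s + 1) * (r + 1) - 1 := by
    refine natDegree_mul_le.trans_lt ?_
    rw [natDegree_X_pow, descPochhammer_natDegree]
    have : (s + 1) * (r + 1) = (s + 1) * r + s + 1 := by ring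
    omega
  have h := ha _ hdeg
  have h2 : (l.factorial : ℚ) * ((∑ i ∈ range (r + 1), ∑ j ∈ range (s + 1),
      a i j * (n * i + j : ℕ) ^ k * ((n * i + j).choose l : ℤ) : ℤ) : ℚ) = 0 := by
    rw [← h]
    push_cast
    simp_rw [mul_sum]
    refine sum_congr rfl fun i _ => sum_congr rfl fun j _ => ?_
    have e : (descPochhammer ℚ l).eval (n * i + j : ℚ) =
        l.factorial * ((n * i + j).choose l : ℚ) := by
      have := descPochhammer_eval_eq_descFactorial ℚ (n * i + j) l
      rw [Nat.descFactorial_eq_factorial_mul_choose] at this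
      push_cast at this
      exact this
    rw [eval_mul, eval_pow, eval_X, e]
    ring
  exact_mod_cast (mul_eq_zero.1 h2).resolve_left (by positivity)

theorem X_sub_one_pow_dvd_pade {n s r : ℕ} {a : ℕ → ℕ → ℤ}
    (ha : ∀ P : ℚ[X], P.natDegree < (s + 1) * (r + 1) - 1 →
      ∑ i ∈ range (r + 1), ∑ j ∈ range (s + 1), (a i j : ℚ) * P.eval (n * i + j : ℚ) = 0)
    {k : ℕ} (hk : k ≤ s) :
    (X - 1) ^ ((s + 1) * r) ∣ ∑ i ∈ range (r + 1), ∑ j ∈ range (s + 1),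
      C (a i j * (n * i + j : ℕ) ^ k) * X ^ (n * i + j) := by
  refine X_sub_one_pow_dvd_of_coeff_comp fun l hl => ?_
  rw [← sum_mul_pow_mul_choose_eq_zero ha hk hl]
  simp only [Polynomial.sum_comp, mul_comp, C_comp, pow_comp, X_comp, finsetSum_coeff, coeff_C_mul,
    coeff_X_add_one_pow]

theorem norm_pade_le {n s r : ℕ} {a : ℕ → ℕ → ℤ}
    (ha : ∀ P : ℚ[X], P.natDegree < (s + 1) * (r + 1) - 1 →
      ∑ i ∈ range (r + 1), ∑ j ∈ range (s + 1), (a i j : ℚ) * P.eval (n * i + j : ℚ) = 0)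
    {k : ℕ} (hk : k ≤ s) {u : ℂ} (hu : ‖u - 1‖ ≤ 1) :
    ‖∑ i ∈ range (r + 1), ∑ j ∈ range (s + 1),
        ((a i j * (n * i + j : ℕ) ^ k : ℤ) : ℂ) * u ^ (n * i + j)‖ ≤
      (∑ i ∈ range (r + 1), ∑ j ∈ range (s + 1),
        |((a i j * (n * i + j : ℕ) ^ k : ℤ) : ℝ)| * 2 ^ (n * i + j)) *
        ‖u - 1‖ ^ ((s + 1) * r) := by
  set b : ℕ → ℕ → ℤ := fun i j => a i j * (n * i + j : ℕ) ^ k with hb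
  set M := n * r + s + 1 with hM
  have hexp : ∀ i ∈ range (r + 1), ∀ j ∈ range (s + 1),
      u ^ (n * i + j) = ∑ l ∈ range M, (u - 1) ^ l * ((n * i + j).choose l : ℂ) := by
    intro i hi j hj
    have hi := mem_range.1 hi
    have hj := mem_range.1 hj
    have hle : n * i + j + 1 ≤ M := by
      have := Nat.mul_le_mul_left n (Nat.lt_succ_iff.1 hi)
      omega
    have := add_pow (u - 1) 1 (n * i + j)
    rw [sub_add_cancel] at this
    rw [this]
    simp only [one_pow, mul_one]
    refine sum_subset (range_mono hle) fun l _ hl => ?_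
    rw [Nat.choose_eq_zero_of_lt (by simpa [Nat.lt_succ_iff] using hl)]
    simp
  have hswap : ∑ i ∈ range (r + 1), ∑ j ∈ range (s + 1), ((b i j : ℤ) : ℂ) * u ^ (n * i + j) =
      ∑ l ∈ range M, (u - 1) ^ l * ((∑ i ∈ range (r + 1), ∑ j ∈ range (s + 1),
        b i j * ((n * i + j).choose l : ℤ) : ℤ) : ℂ) := by
    push_cast
    simp_rw [mul_sum]
    rw [sum_comm (s := range M)]
    refine sum_congr rfl fun i hi => ?_
    rw [sum_comm (s := range M)]
    refine sum_congr rfl fun j hj => ?_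
    rw [hexp i hi j hj, mul_sum]
    exact sum_congr rfl fun l _ => by ring
  rw [hswap]
  calc _ ≤ ∑ l ∈ range M, ‖u - 1‖ ^ ((s + 1) * r) * ∑ i ∈ range (r + 1), ∑ j ∈ range (s + 1),
        |(b i j : ℝ)| * ((n * i + j).choose l : ℝ) := by
        refine (norm_sum_le _ _).trans (sum_le_sum fun l _ => ?_)
        rcases lt_or_ge l ((s + 1) * r) with hl | hl
        · rw [sum_mul_pow_mul_choose_eq_zero ha hk hl]
          simp only [Int.cast_zero, mul_zero, norm_zero]
          positivity
        · rw [norm_mul, norm_pow]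
          refine mul_le_mul (pow_le_pow_of_le_one (norm_nonneg _) hu hl) ?_ (norm_nonneg _)
            (by positivity)
          push_cast
          refine (norm_sum_le _ _).trans (sum_le_sum fun i _ => ?_)
          refine (norm_sum_le _ _).trans (sum_le_sum fun j _ => ?_)
          rw [norm_mul]
          simp
    _ ≤ _ := by
        rw [← mul_sum, mul_comm]
        refine mul_le_mul_of_nonneg_right ?_ (by positivity)
        rw [sum_comm]
        simp_rw [sum_comm (s := range M)]
        refine sum_le_sum fun i hi => sum_le_sum fun j hj => ?_
        rw [← mul_sum]
        refine mul_le_mul_of_nonneg_left ?_ (abs_nonneg _)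
        have hi := mem_range.1 hi
        have hj := mem_range.1 hj
        have hle : n * i + j + 1 ≤ M := by
          have := Nat.mul_le_mul_left n (Nat.lt_succ_iff.1 hi)
          omega
        rw [← sum_subset (range_mono hle)]
        · exact_mod_cast (Nat.sum_range_choose (n * i + j)).le
        · intro l _ hl
          rw [Nat.choose_eq_zero_of_lt (by simpa [Nat.lt_succ_iff] using hl)]
          simp

theorem X_sub_one_pow_dvd_of_comp_X_pow {E : Type*} [Field E] [CharZero E] {n T : ℕ} (hn : n ≠ 0)
    {p : E[X]} (h : (X - 1) ^ T ∣ p.comp (X ^ n)) : (X - 1) ^ T ∣ p := by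
  rcases eq_or_ne p 0 with rfl | hp
  · simp
  obtain ⟨q, hq, hroot⟩ := exists_eq_pow_rootMultiplicity_mul_and_not_dvd p hp 1
  set e := p.rootMultiplicity 1
  rw [C_1] at hq hroot
  by_contra hT
  have heT : e < T := by
    by_contra! hle
    exact hT ((pow_dvd_pow _ hle).trans ⟨q, hq⟩)
  have hg := mul_geom_sum (X : E[X]) n
  rw [hq, mul_comp, pow_comp, sub_comp, X_comp, one_comp, ← hg, mul_pow, mul_assoc] at h
  have h2 : (X - 1 : E[X]) ∣ (∑ i ∈ range n, X ^ i) ^ e * q.comp (X ^ n) := by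
    have h3 : (X - 1 : E[X]) ^ e * (X - 1) ∣
        (X - 1) ^ e * ((∑ i ∈ range n, X ^ i) ^ e * q.comp (X ^ n)) := by
      rw [← pow_succ]
      exact (pow_dvd_pow _ heT).trans h
    exact (mul_dvd_mul_iff_left (pow_ne_zero _ (X_sub_C_ne_zero (1 : E)))).1 h3
  rw [← C_1, dvd_iff_isRoot, IsRoot.def, eval_mul, eval_pow, eval_comp] at h2
  rw [← C_1, dvd_iff_isRoot, IsRoot.def] at hroot
  simp [eval_finsetSum, hn, hroot] at h2

theorem pade_nonvanishing {n s r : ℕ} (hsn : s < n) {a : ℕ → ℕ → ℤ}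
    (ha0 : ∀ j ∈ range (s + 1), a 0 j ≠ 0)
    (hdvd : ∀ k ≤ s, (X - 1) ^ ((s + 1) * r) ∣ ∑ i ∈ range (r + 1), ∑ j ∈ range (s + 1),
      C (a i j * (n * i + j : ℕ) ^ k) * X ^ (n * i + j))
    {E : Type*} [Field E] [CharZero E] {z : E} (hz : z ≠ 1) {y : ℕ → E} (hy : y 0 ≠ 0) :
    ∃ k ≤ s, ∑ i ∈ range (r + 1), ∑ j ∈ range (s + 1),
      ((a i j * (n * i + j : ℕ) ^ k : ℤ) : E) * z ^ i * y j ≠ 0 := by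
  set M : Matrix (Fin (s + 1)) (Fin (s + 1)) E[X] := fun k j =>
    ∑ i ∈ range (r + 1), C ((a i j * (n * i + j : ℕ) ^ (k : ℕ) : ℤ) : E) * X ^ i
  have hMapp : ∀ k j, M k j =
      ∑ i ∈ range (r + 1), C ((a i j * (n * i + j : ℕ) ^ (k : ℕ) : ℤ) : E) * X ^ i :=
    fun _ _ => rfl
  clear_value M
  have hdeg : M.det.natDegree ≤ (s + 1) * r := by
    rw [Matrix.det_apply]
    refine natDegree_sum_le_of_forall_le _ _ fun σ _ => ?_
    refine (natDegree_smul_le _ _).trans ((natDegree_prod_le _ _).trans ?_)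
    refine (sum_le_card_nsmul _ _ r fun k _ => ?_).trans_eq (by simp)
    rw [hMapp]
    refine natDegree_sum_le_of_forall_le _ _ fun i hi => ?_
    exact (natDegree_C_mul_X_pow_le _ _).trans (Nat.lt_succ_iff.1 (mem_range.1 hi))
  have hne : M.det ≠ 0 := by
    have h0 : (evalRingHom (0 : E)) M.det ≠ 0 := by
      rw [RingHom.map_det]
      have : (evalRingHom (0 : E)).mapMatrix M =
          (Matrix.vandermonde fun j : Fin (s + 1) => ((j : ℕ) : E)).transpose *
            Matrix.diagonal fun j : Fin (s + 1) => (a 0 j : E) := by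
        ext k j
        simp only [RingHom.mapMatrix_apply, Matrix.map_apply, hMapp, coe_evalRingHom,
          sum_range_succ']
        simp [eval_finsetSum, Matrix.mul_diagonal, Matrix.vandermonde, mul_comm]
      rw [this, Matrix.det_mul, Matrix.det_transpose, Matrix.det_diagonal]
      refine mul_ne_zero (Matrix.det_vandermonde_ne_zero_iff.2 ?_) (prod_ne_zero_iff.2 ?_)
      · intro i j h
        exact Fin.ext (Nat.cast_injective h)
      · intro j _
        exact_mod_cast ha0 j (mem_range.2 j.2)
    rintro h
    exact h0 (by rw [h, map_zero])
  have hdiv : (X - 1) ^ ((s + 1) * r) ∣ M.det := by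
    apply X_sub_one_pow_dvd_of_comp_X_pow (n := n) (by omega)
    set V : Matrix (Fin (s + 1)) (Fin (s + 1)) E[X] :=
      (compRingHom (X ^ n : E[X])).mapMatrix M * Matrix.diagonal fun j : Fin (s + 1) => X ^ (j : ℕ)
      with hV
    have hcol : ∀ k, (X - 1) ^ ((s + 1) * r) ∣ (V.mulVec 1) k := by
      intro k
      have h1 := Polynomial.map_dvd (Int.castRingHom E) (hdvd k (Nat.lt_succ_iff.1 k.2))
      convert h1 using 1
      · simp
      · simp only [hV, Matrix.mulVec, dotProduct, Matrix.mul_diagonal, Polynomial.map_sum,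
          Polynomial.map_mul, Polynomial.map_pow, map_X, map_C, Pi.one_apply, mul_one]
        rw [sum_comm, ← Fin.sum_univ_eq_sum_range]
        refine sum_congr rfl fun j _ => ?_
        simp only [RingHom.mapMatrix_apply, Matrix.map_apply, hMapp,
          coe_compRingHom_apply, Polynomial.sum_comp, mul_comp, C_comp, pow_comp, X_comp, sum_mul]
        refine sum_congr rfl fun i _ => ?_
        simp [pow_add, pow_mul, mul_assoc]
    have hdet : (X - 1) ^ ((s + 1) * r) ∣ V.det := by
      have h1 : V.adjugate.mulVec (V.mulVec 1) = V.det • 1 := by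
        rw [Matrix.mulVec_mulVec, Matrix.adjugate_mul, Matrix.smul_mulVec, Matrix.one_mulVec]
      have h2 := congrFun h1 0
      simp only [Pi.smul_apply, Pi.one_apply, smul_eq_mul, mul_one] at h2
      rw [← h2, Matrix.mulVec, dotProduct]
      exact Finset.dvd_sum fun k _ =>
        (hcol k).mul_left _
    rw [hV, Matrix.det_mul, Matrix.det_diagonal, ← RingHom.map_det, prod_pow_eq_pow_sum] at hdet
    refine IsCoprime.dvd_of_dvd_mul_right ?_ hdet
    refine IsCoprime.pow ?_
    exact ⟨-1, 1, by ring⟩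
  have heval : M.det.eval z ≠ 0 := by
    obtain ⟨q, hq⟩ := hdiv
    have hmonic : ((X - 1 : E[X]) ^ ((s + 1) * r)).Monic := (monic_X_sub_C (1 : E)).pow _
    have hq0 : q ≠ 0 := by rintro rfl; exact hne (by simpa using hq)
    have hdq : q.natDegree = 0 := by
      have := hmonic.natDegree_mul' hq0
      have h1 : (X - 1 : E[X]).natDegree = 1 := natDegree_X_sub_C (1 : E)
      rw [← hq, natDegree_pow, h1, mul_one] at this
      omega
    rw [eq_C_of_natDegree_eq_zero hdq] at hq hq0
    rw [hq]
    simp only [eval_mul, eval_pow, eval_sub, eval_X, eval_one, eval_C]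
    exact mul_ne_zero (pow_ne_zero _ (sub_ne_zero.2 hz)) (by simpa using hq0)
  by_contra! hcon
  have hker : ((evalRingHom z).mapMatrix M).mulVec (fun j : Fin (s + 1) => y j) = 0 := by
    ext k
    have := hcon k (Nat.lt_succ_iff.1 k.2)
    rw [sum_comm, ← Fin.sum_univ_eq_sum_range
      (fun j => ∑ i ∈ range (r + 1), ((a i j * (n * i + j : ℕ) ^ (k : ℕ) : ℤ) : E) * z ^ i * y j)]
      at this
    simp only [Pi.zero_apply]
    rw [← this]
    simp only [hMapp, Matrix.mulVec, dotProduct, RingHom.mapMatrix_apply, Matrix.map_apply,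
      coe_evalRingHom, eval_finsetSum, eval_mul, eval_C, eval_pow, eval_X, sum_mul]
  have := Matrix.eq_zero_of_mulVec_eq_zero (by rwa [← RingHom.map_det]) hker
  exact hy (by simpa using congrFun this 0)

theorem exists_pade {n s : ℕ} (hsn : s < n) : ∃ B : ℕ, 1 ≤ B ∧ ∀ r, 1 ≤ r →
    ∃ b : ℕ → ℕ → ℕ → ℤ,
      (∀ k ≤ s, (∑ i ∈ range (r + 1), ∑ j ∈ range (s + 1), |(b k i j : ℝ)|) ≤ B ^ r) ∧
      (∀ k ≤ s, ∀ u : ℂ, ‖u - 1‖ ≤ 1 →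
        ‖∑ i ∈ range (r + 1), ∑ j ∈ range (s + 1), (b k i j : ℂ) * u ^ (n * i + j)‖ ≤
          B ^ r * ‖u - 1‖ ^ ((s + 1) * r)) ∧
      ∀ (E : Type) [Field E] [CharZero E] (z : E) (y : ℕ → E), z ≠ 1 → y 0 ≠ 0 →
        ∃ k ≤ s, ∑ i ∈ range (r + 1), ∑ j ∈ range (s + 1), (b k i j : E) * z ^ i * y j ≠ 0 := by
  obtain ⟨A, hA⟩ := exists_pade_coeff hsn
  have hA1 : 1 ≤ A := by
    obtain ⟨a, ha, -⟩ := hA 1 le_rfl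
    have h0 := ha 0 (by simp) 0 (by simp)
    have := Int.one_le_abs h0.1
    have := this.trans h0.2
    simpa using this
  set A₁ := A * (2 * (n + s)) ^ s with hA₁
  have hns : 1 ≤ 2 * (n + s) := by omega
  have hA₁1 : 1 ≤ A₁ := Nat.one_le_iff_ne_zero.2 (by positivity)
  refine ⟨2 * (s + 1) * A₁ * 2 ^ (n + s), Nat.one_le_iff_ne_zero.2 (by positivity), fun r hr => ?_⟩
  obtain ⟨a, ha, hP⟩ := hA r hr
  have h2r : r + 1 ≤ 2 ^ r := Nat.lt_two_pow_self
  have hb : ∀ k ≤ s, ∀ i ∈ range (r + 1), ∀ j ∈ range (s + 1),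
      |((a i j * (n * i + j : ℕ) ^ k : ℤ) : ℝ)| ≤ (A₁ : ℝ) ^ r := by
    intro k hk i hi j hj
    have h1 : |a i j| ≤ (A : ℤ) ^ r := (ha i hi j hj).2
    have hi := Nat.lt_succ_iff.1 (mem_range.1 hi)
    have hj := Nat.lt_succ_iff.1 (mem_range.1 hj)
    have h2 : n * i + j ≤ (2 * (n + s)) ^ r := by
      calc n * i + j ≤ n * r + s * r := by
            gcongr
            exact hj.trans (Nat.le_mul_of_pos_right _ hr)
        _ = (n + s) * r := by ring
        _ ≤ (n + s) ^ r * 2 ^ r := by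
            gcongr
            · exact Nat.le_self_pow (by omega) _
            · omega
        _ = _ := by rw [← mul_pow, mul_comm]
    have h3 : (n * i + j) ^ k ≤ ((2 * (n + s)) ^ r) ^ s :=
      (Nat.pow_le_pow_left h2 k).trans (Nat.pow_le_pow_right (Nat.one_le_pow _ _ hns) hk)
    have h4 : |a i j * (n * i + j : ℕ) ^ k| ≤ (A₁ : ℤ) ^ r := by
      rw [abs_mul, abs_of_nonneg (by positivity : (0 : ℤ) ≤ ((n * i + j : ℕ) : ℤ) ^ k), hA₁]
      push_cast
      rw [mul_pow, ← pow_mul, mul_comm s r, pow_mul]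
      exact mul_le_mul h1 (by exact_mod_cast h3) (by positivity) (by positivity)
    exact_mod_cast h4
  refine ⟨fun k i j => a i j * (n * i + j : ℕ) ^ k, fun k hk => ?_, fun k hk u hu => ?_, ?_⟩
  · calc _ ≤ ∑ i ∈ range (r + 1), ∑ j ∈ range (s + 1), (A₁ : ℝ) ^ r :=
          sum_le_sum fun i hi => sum_le_sum fun j hj => hb k hk i hi j hj
      _ = (r + 1 : ℕ) * (s + 1 : ℕ) * (A₁ : ℝ) ^ r * 1 := by simp; ring
      _ ≤ (2 ^ r : ℕ) * ((s + 1) ^ r : ℕ) * (A₁ : ℝ) ^ r * (2 ^ (n + s)) ^ r := by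
          gcongr
          · exact Nat.le_self_pow (by omega) _
          · exact one_le_pow₀ (one_le_pow₀ (by norm_num))
      _ = _ := by push_cast; simp only [mul_pow]
  · refine (norm_pade_le hP hk hu).trans ?_
    gcongr
    calc _ ≤ ∑ i ∈ range (r + 1), ∑ j ∈ range (s + 1), (A₁ : ℝ) ^ r * (2 ^ (n + s)) ^ r := by
          refine sum_le_sum fun i hi => sum_le_sum fun j hj => ?_
          refine mul_le_mul (hb k hk i hi j hj) ?_ (by positivity) (by positivity)
          rw [← pow_mul]
          refine pow_le_pow_right₀ (by norm_num) ?_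
          have hi := Nat.lt_succ_iff.1 (mem_range.1 hi)
          have hj := Nat.lt_succ_iff.1 (mem_range.1 hj)
          rw [add_mul]
          gcongr
          exact hj.trans (Nat.le_mul_of_pos_right _ hr)
      _ = (r + 1 : ℕ) * (s + 1 : ℕ) * (A₁ : ℝ) ^ r * (2 ^ (n + s)) ^ r := by simp; ring
      _ ≤ (2 ^ r : ℕ) * ((s + 1) ^ r : ℕ) * (A₁ : ℝ) ^ r * (2 ^ (n + s)) ^ r := by
          gcongr
          exact Nat.le_self_pow (by omega) _
      _ = _ := by push_cast; simp only [mul_pow]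
  · intro E _ _ z y hz hy
    exact pade_nonvanishing hsn (fun j hj => (ha 0 (by simp) j hj).1)
      (fun k hk => X_sub_one_pow_dvd_pade hP hk) hz hy

theorem exists_eq_filter_odd_add_two_nsmul {ι : Type*} [DecidableEq ι] (m : Multiset ι) :
    ∃ m' : Multiset ι, m = (m.toFinset.filter fun a => Odd (m.count a)).val + 2 • m' := by
  refine ⟨∑ a ∈ m.toFinset, (m.count a / 2) • {a}, Multiset.ext.2 fun a => ?_⟩
  have h1 : Multiset.count a (∑ x ∈ m.toFinset, (m.count x / 2) • {x}) = m.count a / 2 := by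
    rw [Multiset.count_sum']
    by_cases ha : a ∈ m
    · rw [sum_eq_single a]
      · simp
      · intro b _ hb
        rw [Multiset.count_nsmul, Multiset.count_singleton, if_neg hb.symm, mul_zero]
      · simp [ha]
    · rw [Multiset.count_eq_zero_of_notMem ha, Nat.zero_div, sum_eq_zero]
      intro b hb
      have : a ≠ b := by rintro rfl; exact ha (Multiset.mem_toFinset.1 hb)
      rw [Multiset.count_nsmul, Multiset.count_singleton, if_neg this, mul_zero]
  rw [Multiset.count_add, Multiset.count_nsmul, h1]
  by_cases ho : Odd (m.count a)
  · have hmem : a ∈ (m.toFinset.filter fun a => Odd (m.count a)).val := by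
      rw [mem_val, mem_filter, Multiset.mem_toFinset]
      refine ⟨Multiset.count_pos.1 ?_, ho⟩
      exact ho.pos
    rw [Multiset.count_eq_one_of_mem (nodup _) hmem]
    obtain ⟨k, hk⟩ := ho
    omega
  · have hmem : a ∉ (m.toFinset.filter fun a => Odd (m.count a)).val := by
      rw [mem_val, mem_filter]
      exact fun h => ho h.2
    rw [Multiset.count_eq_zero_of_notMem hmem]
    obtain ⟨k, hk⟩ := Nat.not_odd_iff_even.1 ho
    omega

open UniqueFactorizationMonoid in
/-- If `y g = C k²` and `y`, `g` generate an ideal containing a fixed `e ≠ 0`, then `(y)` is, up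
to the square of an ideal, a product of primes from a fixed finite set. -/
theorem exists_ideal_eq_prod_mul_sq {R : Type*} [CommRing R] [IsDedekindDomain R] {C e : R}
    (hC : C ≠ 0) (he : e ≠ 0) : ∃ S : Finset (Ideal R), ∀ y g k : R, y ≠ 0 → g ≠ 0 →
      y * g = C * k ^ 2 → e ∈ Ideal.span {y, g} →
      ∃ O ⊆ S, ∃ J : Ideal R, J ≠ 0 ∧ Ideal.span {y} = (∏ P ∈ O, P) * J ^ 2 := by
  classical
  refine ⟨(normalizedFactors (Ideal.span {C * e})).toFinset, fun y g k hy hg h he' => ?_⟩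
  have hspan : ∀ {x : R}, x ≠ 0 → Ideal.span {x} ≠ 0 := fun hx => by
    simpa [Ideal.zero_eq_bot, Ideal.span_singleton_eq_bot] using hx
  have hk : k ≠ 0 := by
    rintro rfl
    exact mul_ne_zero hy hg (by simpa using h)
  obtain ⟨m, hm⟩ := exists_eq_filter_odd_add_two_nsmul
    (normalizedFactors (Ideal.span {y}))
  refine ⟨(normalizedFactors (Ideal.span {y})).toFinset.filter fun P =>
    Odd ((normalizedFactors (Ideal.span {y})).count P), ?_, m.prod, ?_, ?_⟩
  rotate_right
  · have := congrArg Multiset.prod hm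
    rw [Multiset.prod_add, Multiset.prod_nsmul] at this
    rw [associated_iff_eq.1 (prod_normalizedFactors (hspan hy)), prod_val] at this
    exact this
  · intro P hP
    rw [mem_filter, Multiset.mem_toFinset] at hP
    obtain ⟨hPy, hodd⟩ := hP
    have hprime := prime_of_normalized_factor P hPy
    rw [Multiset.mem_toFinset]
    have hmem : ∀ {x : R}, x ≠ 0 → (P ∈ normalizedFactors (Ideal.span {x}) ↔ x ∈ P) := by
      intro x hx
      rw [UniqueFactorizationMonoid.mem_normalizedFactors_iff (hspan hx),
        Ideal.dvd_span_singleton, and_iff_right hprime]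
    by_contra hCe
    rw [hmem (mul_ne_zero hC he)] at hCe
    have hyP := (hmem hy).1 hPy
    have hCP : C ∉ P := fun h => hCe (P.mul_mem_right _ h)
    have heP : e ∉ P := fun h => hCe (P.mul_mem_left _ h)
    have hgP : g ∉ P := fun h => heP ((Ideal.span_le.2 (by
      rintro x (rfl | rfl) <;> assumption)) he')
    have hc := congrArg (fun x => (normalizedFactors (Ideal.span {x})).count P) h
    simp only [← Ideal.span_singleton_mul_span_singleton, ← Ideal.span_singleton_pow] at hc
    rw [normalizedFactors_mul (hspan hy) (hspan hg),
      normalizedFactors_mul (hspan hC) (pow_ne_zero 2 (hspan hk)), normalizedFactors_pow,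
      Multiset.count_add, Multiset.count_add, Multiset.count_nsmul,
      Multiset.count_eq_zero_of_notMem (mt (hmem hg).1 hgP),
      Multiset.count_eq_zero_of_notMem (mt (hmem hC).1 hCP)] at hc
    obtain ⟨t, ht⟩ := hodd
    omega
  · rintro h0
    have : (0 : Ideal R) ∈ m := Multiset.prod_eq_zero_iff.1 h0
    have : (0 : Ideal R) ∈ normalizedFactors (Ideal.span {y}) := by
      rw [hm]
      exact Multiset.mem_add.2 (Or.inr (Multiset.mem_nsmul.2 ⟨two_ne_zero, this⟩))
    exact zero_notMem_normalizedFactors _ this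

/-- A squarefree integer polynomial is squarefree over `ℚ`. -/
theorem squarefree_map_castRingHom {f : ℤ[X]} (hf : Squarefree f) :
    Squarefree (f.map (Int.castRingHom ℚ)) := by
  intro g hg
  have hf0 : f.map (Int.castRingHom ℚ) ≠ 0 :=
    (Polynomial.map_ne_zero_iff Int.cast_injective).2 hf.ne_zero
  have hg0 : g ≠ 0 := by
    rintro rfl
    exact hf0 (by simpa using hg)
  obtain ⟨b, hb, hbg⟩ := IsLocalization.integerNormalization_spec (nonZeroDivisors ℤ) g
  obtain ⟨N, hN⟩ : ∃ N, N = IsLocalization.integerNormalization (nonZeroDivisors ℤ) g := ⟨_, rfl⟩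
  rw [← hN] at hbg
  have hdvd : N.primPart.map (Int.castRingHom ℚ) ∣ g := by
    have h1 : N.primPart.map (Int.castRingHom ℚ) ∣ b • g := by
      rw [← hbg]
      exact Polynomial.map_dvd _ N.primPart_dvd
    have hb0 : (b : ℚ) ≠ 0 := by exact_mod_cast nonZeroDivisors.ne_zero hb
    rw [← Int.cast_smul_eq_zsmul ℚ, smul_eq_C_mul] at h1
    exact (IsUnit.dvd_mul_left (isUnit_C.2 (isUnit_iff_ne_zero.2 hb0))).1 h1
  have hunit : IsUnit N.primPart := hf _ <|
    (IsPrimitive.Int.dvd_iff_map_cast_dvd_map_cast _ _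
      (N.isPrimitive_primPart.mul N.isPrimitive_primPart)).2 <| by
      rw [Polynomial.map_mul]
      exact (mul_dvd_mul hdvd hdvd).trans hg
  exact isUnit_or_eq_zero_of_isUnit_integerNormalization_primPart hg0 (hN ▸ hunit)

theorem thue_siegel_inequality {d s n r : ℕ} {B X₁ X₂ : ℝ} (hd : 1 ≤ d) (hs : 1 ≤ s) (hr : 1 ≤ r)
    (hn : n = 8 * s * d ^ 2) (hB : 1 ≤ B) (hX₁ : 2 * B < X₁) (hX₂ : X₁ ^ (1 + n * d + s * d) ≤ X₂)
    (hle : X₂ ^ (2 * s) ≤ X₁ ^ (n * r)) (hge : X₁ ^ (n * (r - 1)) ≤ X₂ ^ (2 * s)) :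
    B ^ r * (X₁ ^ (n * r + s) * X₂ ^ s) ^ d * (1 / X₁ ^ (4 * d * n * r) + 1 / X₂ ^ (8 * s * d)) <
      1 := by
  have h1 : 1 ≤ X₁ := by linarith
  have h2 : 1 ≤ X₂ := (one_le_pow₀ h1).trans hX₂
  have hX₁0 : 0 < X₁ := by linarith
  have hX₂0 : 0 < X₂ := by linarith
  set T := B ^ r * (X₁ ^ (n * r + s) * X₂ ^ s) ^ d with hT
  have hT0 : 0 ≤ T := by positivity
  have hsd : s ≤ n := by rw [hn]; nlinarith [Nat.one_le_pow 2 d hd]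
  have hn1 : 1 ≤ n := hs.trans hsd
  have hs4 : 8 * (s * d) ≤ n := by
    rw [hn]
    nlinarith [Nat.mul_le_mul_left s (Nat.le_self_pow two_ne_zero d)]
  have h2T : 2 * T < X₁ ^ r * (X₁ ^ (n * r + s) * X₂ ^ s) ^ d := by
    rw [hT, ← mul_assoc]
    gcongr
    calc 2 * B ^ r ≤ 2 ^ r * B ^ r := by
          gcongr
          exact le_self_pow₀ (by norm_num) (by omega)
      _ = (2 * B) ^ r := (mul_pow _ _ _).symm
      _ < X₁ ^ r := pow_lt_pow_left₀ hX₁ (by positivity) (by omega)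
  have hc1 : 2 * T < X₁ ^ (4 * d * n * r) := by
    refine h2T.trans_le (le_of_sq_le_sq ?_ (by positivity))
    calc (X₁ ^ r * (X₁ ^ (n * r + s) * X₂ ^ s) ^ d) ^ 2
        = X₁ ^ (2 * r + 2 * d * (n * r + s)) * (X₂ ^ (2 * s)) ^ d := by ring
      _ ≤ X₁ ^ (2 * r + 2 * d * (n * r + s)) * (X₁ ^ (n * r)) ^ d := by gcongr
      _ = X₁ ^ (2 * r + 2 * (s * d) + 3 * (d * n * r)) := by ring
      _ ≤ X₁ ^ (8 * (d * n * r)) := by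
          refine pow_le_pow_right₀ h1 ?_
          have e1 : r ≤ d * n * r := Nat.le_mul_of_pos_left _ (by positivity)
          have e2 : 8 * (s * d) ≤ d * n * r := hs4.trans (by
            calc n ≤ d * n := Nat.le_mul_of_pos_left _ hd
              _ ≤ d * n * r := Nat.le_mul_of_pos_right _ hr)
          omega
      _ = _ := by ring
  have hc2 : 2 * T < X₂ ^ (8 * s * d) := by
    refine h2T.trans_le ?_
    obtain ⟨t, rfl⟩ := Nat.exists_eq_add_of_le' hr
    rw [Nat.add_sub_cancel] at hge
    have e1 : X₁ ^ t ≤ (X₂ ^ (2 * s)) ^ d := by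
      refine le_trans ?_ (pow_le_pow_left₀ (by positivity) hge d)
      rw [← pow_mul]
      exact pow_le_pow_right₀ h1 (by nlinarith [Nat.mul_le_mul hn1 hd])
    calc X₁ ^ (t + 1) * (X₁ ^ (n * (t + 1) + s) * X₂ ^ s) ^ d
        = X₁ ^ t * (X₁ ^ (n * t)) ^ d * X₁ ^ (1 + n * d + s * d) * X₂ ^ (s * d) := by ring
      _ ≤ (X₂ ^ (2 * s)) ^ d * (X₂ ^ (2 * s)) ^ d * X₂ * X₂ ^ (s * d) := by gcongr
      _ = X₂ ^ (5 * (s * d) + 1) := by ring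
      _ ≤ X₂ ^ (8 * s * d) := by
          refine pow_le_pow_right₀ h2 ?_
          have : 1 ≤ s * d := Nat.mul_pos hs hd
          rw [mul_assoc]
          omega
  have e1 : T * (1 / X₁ ^ (4 * d * n * r)) < 1 / 2 := by
    rw [mul_one_div, div_lt_iff₀ (by positivity)]
    linarith
  have e2 : T * (1 / X₂ ^ (8 * s * d)) < 1 / 2 := by
    rw [mul_one_div, div_lt_iff₀ (by positivity)]
    linarith
  rw [mul_add]
  linarith

theorem norm_pow_sub_one_le {u : ℂ} (hu : ‖u - 1‖ ≤ 1) (m : ℕ) :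
    ‖u ^ m - 1‖ ≤ (2 ^ m - 1) * ‖u - 1‖ := by
  have hu2 : ‖u‖ ≤ 2 := by
    have := norm_add_le (u - 1) 1
    rw [sub_add_cancel, norm_one] at this
    linarith
  induction m with
  | zero => simp
  | succ m ih =>
    have e : u ^ (m + 1) - 1 = u * (u ^ m - 1) + (u - 1) := by ring
    calc ‖u ^ (m + 1) - 1‖ ≤ ‖u‖ * ‖u ^ m - 1‖ + ‖u - 1‖ := by
          rw [e, ← norm_mul]
          exact norm_add_le _ _
      _ ≤ 2 * ((2 ^ m - 1) * ‖u - 1‖) + ‖u - 1‖ := by gcongr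
      _ = _ := by ring

theorem norm_pade_form_le {n s r : ℕ} (hr : 1 ≤ r) {b : ℕ → ℕ → ℤ} {B : ℝ} (hB : 0 ≤ B) {u₁ u₂ : ℂ}
    (h₁ : ‖u₁ - 1‖ ≤ 1) (h₂ : ‖u₂ - 1‖ ≤ 1)
    (hsum : ∑ i ∈ range (r + 1), ∑ j ∈ range (s + 1), |(b i j : ℝ)| ≤ B ^ r)
    (hpade : ‖∑ i ∈ range (r + 1), ∑ j ∈ range (s + 1), (b i j : ℂ) * u₁ ^ (n * i + j)‖ ≤
      B ^ r * ‖u₁ - 1‖ ^ ((s + 1) * r)) :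
    ‖∑ i ∈ range (r + 1), ∑ j ∈ range (s + 1),
        (b i j : ℂ) * (u₁ ^ n) ^ i * (u₁ ^ j * u₂ ^ (s - j))‖ ≤
      (B * 2 ^ (n + 2 * s)) ^ r * (‖u₁ - 1‖ ^ ((s + 1) * r) + ‖u₂ - 1‖) := by
  have hu2 : ‖u₁‖ ≤ 2 := by
    have := norm_add_le (u₁ - 1) 1
    rw [sub_add_cancel, norm_one] at this
    linarith
  have hsplit : ∑ i ∈ range (r + 1), ∑ j ∈ range (s + 1),
        (b i j : ℂ) * (u₁ ^ n) ^ i * (u₁ ^ j * u₂ ^ (s - j)) =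
      (∑ i ∈ range (r + 1), ∑ j ∈ range (s + 1), (b i j : ℂ) * u₁ ^ (n * i + j)) +
      ∑ i ∈ range (r + 1), ∑ j ∈ range (s + 1),
        (b i j : ℂ) * (u₁ ^ (n * i + j) * (u₂ ^ (s - j) - 1)) := by
    rw [← sum_add_distrib]
    refine sum_congr rfl fun i _ => ?_
    rw [← sum_add_distrib]
    exact sum_congr rfl fun j _ => by ring
  have h2 : ‖∑ i ∈ range (r + 1), ∑ j ∈ range (s + 1),
        (b i j : ℂ) * (u₁ ^ (n * i + j) * (u₂ ^ (s - j) - 1))‖ ≤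
      B ^ r * (2 ^ (n + 2 * s)) ^ r * ‖u₂ - 1‖ := by
    calc _ ≤ ∑ i ∈ range (r + 1), ∑ j ∈ range (s + 1),
          |(b i j : ℝ)| * ((2 ^ (n + 2 * s)) ^ r * ‖u₂ - 1‖) := by
          refine (norm_sum_le _ _).trans (sum_le_sum fun i hi => ?_)
          refine (norm_sum_le _ _).trans (sum_le_sum fun j hj => ?_)
          have hi := Nat.lt_succ_iff.1 (mem_range.1 hi)
          have hj := Nat.lt_succ_iff.1 (mem_range.1 hj)
          rw [norm_mul, norm_mul, norm_pow, Complex.norm_intCast]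
          refine mul_le_mul_of_nonneg_left ?_ (abs_nonneg _)
          calc ‖u₁‖ ^ (n * i + j) * ‖u₂ ^ (s - j) - 1‖
              ≤ 2 ^ (n * i + j) * (2 ^ s * ‖u₂ - 1‖) := by
                gcongr
                refine (norm_pow_sub_one_le h₂ _).trans ?_
                gcongr
                have : (2 : ℝ) ^ (s - j) ≤ 2 ^ s := pow_le_pow_right₀ (by norm_num) (by omega)
                linarith
            _ = 2 ^ (n * i + j + s) * ‖u₂ - 1‖ := by ring
            _ ≤ (2 ^ (n + 2 * s)) ^ r * ‖u₂ - 1‖ := by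
                rw [← pow_mul]
                gcongr
                · norm_num
                · have e1 := Nat.mul_le_mul_left n hi
                  have e2 : s ≤ s * r := Nat.le_mul_of_pos_right _ hr
                  have e3 : (n + 2 * s) * r = n * r + 2 * (s * r) := by ring
                  omega
      _ = (∑ i ∈ range (r + 1), ∑ j ∈ range (s + 1), |(b i j : ℝ)|) *
            ((2 ^ (n + 2 * s)) ^ r * ‖u₂ - 1‖) := by simp_rw [sum_mul]
      _ ≤ B ^ r * ((2 ^ (n + 2 * s)) ^ r * ‖u₂ - 1‖) := by gcongr
      _ = _ := by ring
  rw [hsplit, mul_add, mul_pow]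
  refine (norm_add_le _ _).trans (add_le_add (hpade.trans ?_) h2)
  gcongr
  exact le_mul_of_one_le_right (by positivity) (one_le_pow₀ (one_le_pow₀ (by norm_num)))

section NumberField

open NumberField Module

variable {K : Type} [Field K] [NumberField K]

theorem one_le_norm_mul_house_pow {x : 𝓞 K} (hx : x ≠ 0) (σ : K →+* ℂ) :
    1 ≤ ‖σ x‖ * house (x : K) ^ (finrank ℚ K - 1) := by
  refine le_trans ?_ (norm_norm_le_norm_mul_house_pow (x : K) σ)
  rw [← Algebra.coe_norm_int, Int.norm_cast_rat, Int.norm_eq_abs]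
  exact_mod_cast Int.one_le_abs ((Algebra.norm_ne_zero_iff_of_basis (RingOfIntegers.basis K)).2 hx)

theorem exists_intCast_mul_eq_ringOfIntegers (A : K) :
    ∃ q : ℤ, q ≠ 0 ∧ ∃ A' : 𝓞 K, (A' : K) = q * A := by
  obtain ⟨q, hq, hA⟩ := exists_integral_multiples ℤ ℚ {A}
  exact ⟨q, hq, ⟨q • A, hA A (by simp)⟩, by simp⟩

theorem house_pade_form_le {n s r : ℕ} {q : ℤ} {b : ℕ → ℕ → ℤ} {B a : ℝ}
    (hsum : ∑ i ∈ range (r + 1), ∑ j ∈ range (s + 1), |(b i j : ℝ)| ≤ B ^ r)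
    {A x₁ x₂ : K} (ha : 1 ≤ a) (hq : |(q : ℝ)| ≤ a) (hA : house A ≤ a)
    (h₁ : 1 ≤ house x₁) (h₂ : 1 ≤ house x₂) :
    house (∑ i ∈ range (r + 1), ∑ j ∈ range (s + 1),
        (b i j : K) * q ^ (r - i) * (A * x₁ ^ n) ^ i * (x₁ ^ j * x₂ ^ (s - j))) ≤
      (B * a) ^ r * (house x₁ ^ (n * r + s) * house x₂ ^ s) := by
  have hh : ∀ x : K, 0 ≤ house x := house_nonneg
  calc _ ≤ ∑ i ∈ range (r + 1), ∑ j ∈ range (s + 1),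
        |(b i j : ℝ)| * (a ^ r * (house x₁ ^ (n * r + s) * house x₂ ^ s)) := by
        refine (house_sum_le_sum_house _ _).trans (sum_le_sum fun i hi => ?_)
        refine (house_sum_le_sum_house _ _).trans (sum_le_sum fun j hj => ?_)
        have hi := Nat.lt_succ_iff.1 (mem_range.1 hi)
        have hj := Nat.lt_succ_iff.1 (mem_range.1 hj)
        have e : (b i j : K) * q ^ (r - i) * (A * x₁ ^ n) ^ i * (x₁ ^ j * x₂ ^ (s - j)) =
          (b i j : K) * (((q ^ (r - i) : ℤ) : K) * A ^ i *
            (x₁ ^ (n * i + j) * x₂ ^ (s - j))) := by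
          push_cast
          ring
        rw [e]
        refine (house_mul_le _ _).trans ?_
        rw [house_intCast, Int.cast_abs]
        refine mul_le_mul_of_nonneg_left ?_ (abs_nonneg _)
        refine (house_mul_le _ _).trans (mul_le_mul ?_ ?_ (hh _) (by positivity))
        · refine (house_mul_le _ _).trans ?_
          rw [house_intCast]
          calc _ ≤ a ^ (r - i) * a ^ i := by
                refine mul_le_mul ?_ ((house_pow_le _ _).trans
                  (pow_le_pow_left₀ (hh _) hA _)) (hh _) (by positivity)
                simpa using pow_le_pow_left₀ (abs_nonneg _) hq (r - i)
            _ = a ^ r := by rw [← pow_add, Nat.sub_add_cancel hi]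
        · refine (house_mul_le _ _).trans (mul_le_mul ?_ ?_ (hh _) (pow_nonneg (hh _) _))
          · refine (house_pow_le _ _).trans (pow_le_pow_right₀ h₁ ?_)
            have := Nat.mul_le_mul_left n hi
            omega
          · exact (house_pow_le _ _).trans (pow_le_pow_right₀ h₂ (Nat.sub_le _ _))
    _ = (∑ i ∈ range (r + 1), ∑ j ∈ range (s + 1), |(b i j : ℝ)|) *
          (a ^ r * (house x₁ ^ (n * r + s) * house x₂ ^ s)) := by simp_rw [sum_mul]
    _ ≤ B ^ r * (a ^ r * (house x₁ ^ (n * r + s) * house x₂ ^ s)) := by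
        refine mul_le_mul_of_nonneg_right hsum ?_
        have := hh x₁
        have := hh x₂
        positivity
    _ = _ := by ring

theorem thue_siegel {d s n M : ℕ} (hd : finrank ℚ K = d) (hs : s + 1 = 4 * d ^ 2)
    (hn : n = 8 * s * d ^ 2) (hM : M = 8 * s * d) (σ : K →+* ℂ) {A : K} {γ : ℂ}
    (hγ : σ A * γ ^ n = 1) (C₀ : ℝ) :
    ∃ R : ℝ, ∀ (η₁ η₂ : 𝓞 K) (u₁ u₂ : ℂ), A * η₁ ^ n ≠ 1 → σ η₁ = γ * u₁ → σ η₂ = γ * u₂ →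
      ‖u₁ - 1‖ * house (η₁ : K) ^ M ≤ C₀ → ‖u₂ - 1‖ * house (η₂ : K) ^ M ≤ C₀ →
      R < house (η₁ : K) → house (η₂ : K) < house (η₁ : K) ^ (1 + n * d + s * d) := by
  have hd1 : 1 ≤ d := hd ▸ finrank_pos
  have hs1 : 1 ≤ s := by have := Nat.one_le_pow 2 d hd1; omega
  have hM1 : M ≠ 0 := by rw [hM]; positivity
  have hsn : s < n := by rw [hn]; nlinarith [Nat.one_le_pow 2 d hd1]
  have hMs : M * (s + 1) = 4 * d * n := by rw [hM, hs, hn]; ring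
  obtain ⟨B, hB1, hB⟩ := exists_pade hsn
  have hB1 : (1 : ℝ) ≤ B := by exact_mod_cast hB1
  obtain ⟨q, hq, A', hA'⟩ := exists_intCast_mul_eq_ringOfIntegers A
  have hq1 : (1 : ℝ) ≤ |(q : ℝ)| := by exact_mod_cast Int.one_le_abs hq
  obtain ⟨a, ha1, hqa, hAa⟩ : ∃ a : ℝ, 1 ≤ a ∧ |(q : ℝ)| ≤ a ∧ house (A' : K) ≤ a :=
    ⟨max 1 (max |(q : ℝ)| (house (A' : K))), by simp, by simp, by simp⟩
  obtain ⟨g, hg1, hγg⟩ : ∃ g : ℝ, 1 ≤ g ∧ ‖γ‖ ≤ g := ⟨max 1 ‖γ‖, by simp, by simp⟩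
  obtain ⟨C, hC1, hC⟩ : ∃ C : ℝ, 1 ≤ C ∧ C₀ ≤ C := ⟨max 1 C₀, by simp, by simp⟩
  set D : ℝ := |(q : ℝ)| * g ^ s * (B * 2 ^ (n + 2 * s)) * C ^ (s + 1) * (B * a) ^ d with hD
  have hDpos : 1 ≤ D := by
    have e1 : (1 : ℝ) ≤ g ^ s := one_le_pow₀ hg1
    have e2 : (1 : ℝ) ≤ 2 ^ (n + 2 * s) := one_le_pow₀ (by norm_num)
    have e3 : (1 : ℝ) ≤ C ^ (s + 1) := one_le_pow₀ hC1
    have e4 : (1 : ℝ) ≤ (B * a) ^ d := one_le_pow₀ (one_le_mul_of_one_le_of_one_le hB1 ha1)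
    exact one_le_mul_of_one_le_of_one_le (one_le_mul_of_one_le_of_one_le
      (one_le_mul_of_one_le_of_one_le (one_le_mul_of_one_le_of_one_le hq1 e1)
        (one_le_mul_of_one_le_of_one_le hB1 e2)) e3) e4
  refine ⟨max (2 * D) C, fun η₁ η₂ u₁ u₂ hne hσ₁ hσ₂ hu₁ hu₂ hR => ?_⟩
  by_contra! hX
  set X₁ := house (η₁ : K) with hX₁
  set X₂ := house (η₂ : K) with hX₂
  obtain ⟨hR2, hRC⟩ := max_lt_iff.1 hR
  have hX₁1 : 1 < X₁ := by linarith
  have hX₁₂ : X₁ ≤ X₂ := (le_self_pow₀ hX₁1.le (by omega)).trans hX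
  have hX₂1 : 1 < X₂ := hX₁1.trans_le hX₁₂
  have hdelta : ∀ (u : ℂ) (x : ℝ), C < x → ‖u - 1‖ * x ^ M ≤ C₀ →
      ‖u - 1‖ ≤ C / x ^ M ∧ ‖u - 1‖ ≤ 1 := by
    intro u x hx hu
    have h1 : 1 ≤ x := by linarith
    have h2 : ‖u - 1‖ ≤ C / x ^ M := by
      rw [le_div_iff₀ (by positivity)]
      linarith
    refine ⟨h2, h2.trans ?_⟩
    rw [div_le_one (by positivity)]
    exact hx.le.trans (le_self_pow₀ h1 hM1)
  obtain ⟨hδ₁, hδ₁1⟩ := hdelta u₁ X₁ hRC hu₁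
  obtain ⟨hδ₂, hδ₂1⟩ := hdelta u₂ X₂ (hRC.trans_le hX₁₂) hu₂
  have hex : ∃ r : ℕ, X₂ ^ (2 * s) ≤ X₁ ^ (n * r) := by
    obtain ⟨r, hr⟩ := pow_unbounded_of_one_lt (X₂ ^ (2 * s)) hX₁1
    exact ⟨r, hr.le.trans (pow_le_pow_right₀ hX₁1.le (Nat.le_mul_of_pos_left _ (by omega)))⟩
  classical
  obtain ⟨r, hr1, hle, hge⟩ : ∃ r : ℕ, 1 ≤ r ∧ X₂ ^ (2 * s) ≤ X₁ ^ (n * r) ∧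
      X₁ ^ (n * (r - 1)) ≤ X₂ ^ (2 * s) := by
    have h0 : Nat.find hex ≠ 0 := by
      intro h
      have := Nat.find_spec hex
      rw [h, mul_zero, pow_zero] at this
      exact absurd this (not_le.2 (one_lt_pow₀ hX₂1 (by omega)))
    refine ⟨Nat.find hex, Nat.one_le_iff_ne_zero.2 h0, Nat.find_spec hex, ?_⟩
    exact (not_le.1 (Nat.find_min hex (Nat.sub_lt (Nat.pos_of_ne_zero h0) one_pos))).le
  have hfinal := thue_siegel_inequality hd1 hs1 hr1 hn hDpos hR2 hX hle hge
  obtain ⟨b, hbsum, hbpade, hbne⟩ := hB r hr1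
  have hη₂ : (η₂ : K) ≠ 0 := by
    rintro h
    rw [hX₂, h] at hX₂1
    simp [house] at hX₂1
    linarith
  obtain ⟨k, hk, hkne⟩ := hbne K (A * η₁ ^ n) (fun j => (η₁ : K) ^ j * (η₂ : K) ^ (s - j)) hne
    (by simpa using pow_ne_zero s hη₂)
  set Λ : 𝓞 K := ∑ i ∈ range (r + 1), ∑ j ∈ range (s + 1),
    (b k i j : 𝓞 K) * q ^ (r - i) * (A' * η₁ ^ n) ^ i * (η₁ ^ j * η₂ ^ (s - j)) with hΛ
  have hΛK : (Λ : K) = ∑ i ∈ range (r + 1), ∑ j ∈ range (s + 1),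
      (b k i j : K) * q ^ (r - i) * (A' * η₁ ^ n) ^ i * ((η₁ : K) ^ j * (η₂ : K) ^ (s - j)) := by
    simp [hΛ, map_sum]
  have hΛ' : (Λ : K) = q ^ r * ∑ i ∈ range (r + 1), ∑ j ∈ range (s + 1),
      (b k i j : K) * (A * η₁ ^ n) ^ i * ((η₁ : K) ^ j * (η₂ : K) ^ (s - j)) := by
    rw [hΛK, mul_sum]
    refine sum_congr rfl fun i hi => ?_
    rw [mul_sum]
    refine sum_congr rfl fun j hj => ?_
    have hi := Nat.lt_succ_iff.1 (mem_range.1 hi)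
    rw [hA', ← pow_sub_mul_pow (q : K) hi]
    ring
  have hΛ0 : Λ ≠ 0 := by
    rintro h
    rw [h] at hΛ'
    have hqK : (q : K) ≠ 0 := by exact_mod_cast hq
    exact mul_ne_zero (pow_ne_zero r hqK) hkne (by rw [← hΛ']; simp)
  have hσΛ : σ Λ = q ^ r * γ ^ s * ∑ i ∈ range (r + 1), ∑ j ∈ range (s + 1),
      (b k i j : ℂ) * (u₁ ^ n) ^ i * (u₁ ^ j * u₂ ^ (s - j)) := by
    rw [hΛ', mul_assoc, map_mul, map_pow, map_intCast, map_sum, mul_sum (a := γ ^ s)]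
    congr 1
    refine sum_congr rfl fun i _ => ?_
    rw [map_sum, mul_sum]
    refine sum_congr rfl fun j hj => ?_
    have hj := Nat.lt_succ_iff.1 (mem_range.1 hj)
    have e : σ A * (γ * u₁) ^ n = u₁ ^ n := by rw [mul_pow, ← mul_assoc, hγ, one_mul]
    simp only [map_mul, map_pow, map_intCast, hσ₁, hσ₂]
    rw [e, ← pow_sub_mul_pow γ hj]
    ring
  have h1 := one_le_norm_mul_house_pow hΛ0 σ
  refine absurd h1 (not_le.2 (lt_of_le_of_lt ?_ hfinal))
  have hσΛle : ‖σ Λ‖ ≤ (|(q : ℝ)| * g ^ s * (B * 2 ^ (n + 2 * s)) * C ^ (s + 1)) ^ r *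
      (1 / X₁ ^ (4 * d * n * r) + 1 / X₂ ^ (8 * s * d)) := by
    have e1 : ‖u₁ - 1‖ ^ ((s + 1) * r) ≤ (C ^ (s + 1)) ^ r * (1 / X₁ ^ (4 * d * n * r)) := by
      refine (pow_le_pow_left₀ (norm_nonneg _) hδ₁ _).trans_eq ?_
      rw [← hMs, div_pow, mul_one_div, ← pow_mul, ← pow_mul, mul_assoc]
    have e2 : ‖u₂ - 1‖ ≤ (C ^ (s + 1)) ^ r * (1 / X₂ ^ (8 * s * d)) := by
      refine hδ₂.trans ?_
      rw [hM, mul_one_div, ← pow_mul]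
      gcongr
      exact le_self_pow₀ hC1 (by positivity)
    have e3 := norm_pade_form_le hr1 (by linarith) hδ₁1 hδ₂1 (hbsum k hk) (hbpade k hk u₁ hδ₁1)
    rw [hσΛ, norm_mul, norm_mul, norm_pow, norm_pow, Complex.norm_intCast]
    calc _ ≤ |(q : ℝ)| ^ r * (g ^ s) ^ r * ((B * 2 ^ (n + 2 * s)) ^ r *
          ((C ^ (s + 1)) ^ r * (1 / X₁ ^ (4 * d * n * r)) +
            (C ^ (s + 1)) ^ r * (1 / X₂ ^ (8 * s * d)))) := by
          gcongr
          · refine (pow_le_pow_left₀ (norm_nonneg _) hγg s).trans ?_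
            exact le_self_pow₀ (one_le_pow₀ hg1) (by omega)
          · exact e3.trans (by gcongr)
      _ = _ := by simp only [mul_pow]; ring
  have hhouse := house_pade_form_le (n := n) (hbsum k hk) ha1 hqa hAa hX₁1.le hX₂1.le
  rw [← hΛK] at hhouse
  calc ‖σ Λ‖ * house (Λ : K) ^ (finrank ℚ K - 1)
      ≤ ‖σ Λ‖ * ((B * a) ^ r * (X₁ ^ (n * r + s) * X₂ ^ s)) ^ d := by
        gcongr
        refine (pow_le_pow_left₀ (house_nonneg _) hhouse _).trans ?_
        refine pow_le_pow_right₀ ?_ (by omega)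
        exact one_le_mul_of_one_le_of_one_le
          (one_le_pow₀ (one_le_mul_of_one_le_of_one_le hB1 ha1))
          (one_le_mul_of_one_le_of_one_le (one_le_pow₀ hX₁1.le) (one_le_pow₀ hX₂1.le))
    _ ≤ _ := mul_le_mul_of_nonneg_right hσΛle (by positivity)
    _ = _ := by
        rw [hD]
        simp only [mul_pow]
        ring

theorem exists_norm_eq_house (x : K) : ∃ σ : K →+* ℂ, ‖σ x‖ = house x := by
  rw [house_eq_sup']
  obtain ⟨σ, -, hσ⟩ := exists_mem_eq_sup' (univ_nonempty (α := K →+* ℂ)) fun φ => ‖φ x‖₊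
  exact ⟨σ, by rw [hσ]; rfl⟩

theorem house_pow_eq (x : K) (n : ℕ) : house (x ^ n) = house x ^ n := by
  refine (house_pow_le x n).antisymm ?_
  obtain ⟨σ, hσ⟩ := exists_norm_eq_house x
  rw [← hσ, ← norm_pow, ← map_pow]
  exact norm_embedding_le_house _ _

theorem finite_setOf_house_le (R : ℝ) : {x : 𝓞 K | house (x : K) ≤ R}.Finite := by
  refine ((Embeddings.finite_of_norm_le K ℂ R).preimage
    (f := fun x : 𝓞 K => (x : K)) RingOfIntegers.coe_injective.injOn).subset fun x hx => ?_
  exact ⟨x.isIntegral_coe, fun φ => (norm_embedding_le_house _ φ).trans hx⟩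

theorem exists_lt_house_of_infinite {S : Set (𝓞 K)} (hS : S.Infinite) (R : ℝ) :
    ∃ x ∈ S, R < house (x : K) := by
  by_contra! h
  exact hS ((finite_setOf_house_le R).subset h)

theorem finite_setOf_approx {d s n M : ℕ} (hd : finrank ℚ K = d) (hs : s + 1 = 4 * d ^ 2)
    (hn : n = 8 * s * d ^ 2) (hM : M = 8 * s * d) (σ : K →+* ℂ) {A : K} {γ : ℂ}
    (hγ : σ A * γ ^ n = 1) (C : ℝ) :
    {η : 𝓞 K | A * η ^ n ≠ 1 ∧ ∃ u : ℂ, σ η = γ * u ∧ ‖u - 1‖ * house (η : K) ^ M ≤ C}.Finite := by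
  obtain ⟨R, hR⟩ := thue_siegel hd hs hn hM σ hγ C
  by_contra hS
  obtain ⟨η₁, ⟨h₁, u₁, hu₁, hC₁⟩, hη₁⟩ := exists_lt_house_of_infinite hS R
  obtain ⟨η₂, ⟨-, u₂, hu₂, hC₂⟩, hη₂⟩ :=
    exists_lt_house_of_infinite hS (house (η₁ : K) ^ (1 + n * d + s * d))
  exact lt_asymm hη₂ (hR η₁ η₂ u₁ u₂ h₁ hu₁ hu₂ hC₁ hC₂ hη₁)

theorem exists_rootOfUnity_norm_sub_le {n : ℕ} (hn : n ≠ 0) :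
    ∃ C : ℝ, 0 ≤ C ∧ ∀ w : ℂ, ∃ ζ : ℂ, ζ ^ n = 1 ∧ ‖w - ζ‖ ≤ C * ‖w ^ n - 1‖ := by
  classical
  set Z := nthRootsFinset n (1 : ℂ) with hZ
  set c : ℂ → ℝ := fun ζ => ∏ ξ ∈ Z.erase ζ, (‖ξ - ζ‖ / 2) with hc
  have hc0 : ∀ ζ, 0 < c ζ := fun ζ => prod_pos fun ξ hξ => by
    have := norm_pos_iff.2 (sub_ne_zero.2 (ne_of_mem_erase hξ))
    positivity
  refine ⟨∑ ζ ∈ Z, (c ζ)⁻¹, sum_nonneg fun ζ _ => (inv_pos.2 (hc0 ζ)).le, fun w => ?_⟩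
  have hne : Z.Nonempty := ⟨1, by rw [hZ, mem_nthRootsFinset (Nat.pos_of_ne_zero hn)]; simp⟩
  obtain ⟨ζ, hζ, hmin⟩ := exists_min_image Z (fun ζ => ‖w - ζ‖) hne
  refine ⟨ζ, (mem_nthRootsFinset (Nat.pos_of_ne_zero hn) 1).1 hζ, ?_⟩
  have hfac : w ^ n - 1 = ∏ ξ ∈ Z, (w - ξ) := by
    have := congrArg (eval w) (X_pow_sub_one_eq_prod (Nat.pos_of_ne_zero hn)
      (Complex.isPrimitiveRoot_exp n hn))
    simpa [eval_prod] using this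
  have hle : c ζ ≤ ∏ ξ ∈ Z.erase ζ, ‖w - ξ‖ := by
    refine prod_le_prod (fun ξ _ => by positivity) fun ξ hξ => ?_
    have h1 := hmin ξ (mem_of_mem_erase hξ)
    have h2 := norm_sub_le (w - ζ) (w - ξ)
    rw [sub_sub_sub_cancel_left] at h2
    linarith
  have hbig : (c ζ)⁻¹ ≤ ∑ ζ ∈ Z, (c ζ)⁻¹ :=
    single_le_sum (f := fun ζ => (c ζ)⁻¹) (fun ζ _ => (inv_pos.2 (hc0 ζ)).le) hζ
  calc ‖w - ζ‖ ≤ (c ζ)⁻¹ * ‖w ^ n - 1‖ := by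
        rw [inv_mul_eq_div, le_div_iff₀ (hc0 ζ), hfac, norm_prod, ← mul_prod_erase Z _ hζ]
        gcongr
    _ ≤ _ := by gcongr

theorem exists_norm_unit_pow_mul_house_le_one (ε : (𝓞 K)ˣ) :
    ∃ σ : K →+* ℂ, ‖σ ε‖ ^ finrank ℚ K * house ((ε : 𝓞 K) : K) ≤ 1 := by
  obtain ⟨σ, hσ⟩ := exists_norm_eq_house (((ε⁻¹ : (𝓞 K)ˣ) : 𝓞 K) : K)
  obtain ⟨τ, hτ⟩ := exists_norm_eq_house ((ε : 𝓞 K) : K)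
  have hinv : ∀ φ : K →+* ℂ, ‖φ ε‖ * ‖φ (ε⁻¹ : (𝓞 K)ˣ)‖ = 1 := by
    intro φ
    rw [← norm_mul, ← map_mul, ← RingOfIntegers.coe_eq_algebraMap,
      ← RingOfIntegers.coe_eq_algebraMap]
    norm_cast
    simp
  refine ⟨σ, ?_⟩
  have h1 := one_le_norm_mul_house_pow (Units.ne_zero ε⁻¹) τ
  have hge : 1 ≤ house (((ε⁻¹ : (𝓞 K)ˣ) : 𝓞 K) : K) :=
    one_le_house_of_isIntegral (RingOfIntegers.isIntegral_coe _) (by simp)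
  have h3 := hinv σ
  have h4 := hinv τ
  rw [hσ] at h3
  rw [hτ] at h4
  set H := house (((ε⁻¹ : (𝓞 K)ˣ) : 𝓞 K) : K)
  set X := house ((ε : 𝓞 K) : K)
  have hX0 : 0 ≤ X := house_nonneg _
  have hXle : X ≤ H ^ (finrank ℚ K - 1) := by
    calc X = X * 1 := (mul_one X).symm
      _ ≤ X * (‖τ (ε⁻¹ : (𝓞 K)ˣ)‖ * H ^ (finrank ℚ K - 1)) := by gcongr
      _ = H ^ (finrank ℚ K - 1) := by rw [← mul_assoc, h4, one_mul]
  calc ‖σ ε‖ ^ finrank ℚ K * X ≤ ‖σ ε‖ ^ finrank ℚ K * H ^ finrank ℚ K := by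
        gcongr
        exact hXle.trans (pow_le_pow_right₀ hge (Nat.sub_le _ _))
    _ = 1 := by rw [← mul_pow, h3, one_pow]

/-- The unit group modulo `n`-th powers is finite. -/
theorem exists_finset_unit_reps {n : ℕ} (hn : n ≠ 0) :
    ∃ T : Finset (𝓞 K)ˣ, ∀ ε : (𝓞 K)ˣ, ∃ a ∈ T, ∃ η : (𝓞 K)ˣ, ε = a * η ^ n := by
  classical
  have : Group.FG (𝓞 K)ˣ := Group.fg_iff_monoid_fg.2 inferInstance
  have : (powMonoidHom (α := (𝓞 K)ˣ) n).range.FiniteIndex :=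
    Subgroup.finiteIndex_range_powMonoidHom_of_fg _ hn
  have := Fintype.ofFinite ((𝓞 K)ˣ ⧸ (powMonoidHom (α := (𝓞 K)ˣ) n).range)
  refine ⟨univ.image fun x : (𝓞 K)ˣ ⧸ (powMonoidHom (α := (𝓞 K)ˣ) n).range => x.out, fun ε => ?_⟩
  obtain ⟨⟨_, η, rfl⟩, h⟩ := QuotientGroup.mk_out_eq_mul (powMonoidHom (α := (𝓞 K)ˣ) n).range ε
  refine ⟨_, mem_image_of_mem _ (mem_univ (ε : (𝓞 K)ˣ ⧸ (powMonoidHom (α := (𝓞 K)ˣ) n).range)),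
    η⁻¹, ?_⟩
  rw [h]
  simp

/-- The two-variable unit equation `α ε₁ + β ε₂ = 1` has finitely many solutions in units of
`𝓞 K`. -/
theorem finite_unit_equation_fst {α β : K} (hα : α ≠ 0) (hβ : β ≠ 0) :
    {ε₁ : (𝓞 K)ˣ | ∃ ε₂ : (𝓞 K)ˣ, α * ε₁ + β * ε₂ = 1}.Finite := by
  obtain ⟨d, hd⟩ : ∃ d, finrank ℚ K = d := ⟨_, rfl⟩
  have hd1 : 1 ≤ d := hd ▸ finrank_pos
  obtain ⟨s, hs⟩ : ∃ s, s + 1 = 4 * d ^ 2 :=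
    ⟨4 * d ^ 2 - 1, Nat.sub_add_cancel (by have := Nat.one_le_pow 2 d hd1; omega)⟩
  have hs1 : 1 ≤ s := by have := Nat.one_le_pow 2 d hd1; omega
  obtain ⟨M, hM⟩ : ∃ M, M = 8 * s * d := ⟨_, rfl⟩
  obtain ⟨n, hn⟩ : ∃ n, n = 8 * s * d ^ 2 := ⟨_, rfl⟩
  have hnM : n = M * d := by rw [hn, hM]; ring
  have hn0 : n ≠ 0 := by rw [hn]; positivity
  obtain ⟨T, hT⟩ := exists_finset_unit_reps (K := K) hn0
  obtain ⟨C, hC0, hC⟩ := exists_rootOfUnity_norm_sub_le hn0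
  have hroot : ∀ (a : (𝓞 K)ˣ) (σ : K →+* ℂ), ∃ γ : ℂ, σ (α * a) * γ ^ n = 1 := by
    intro a σ
    obtain ⟨γ, hγ⟩ := IsAlgClosed.exists_pow_nat_eq (σ (α * a))⁻¹ (Nat.pos_of_ne_zero hn0)
    exact ⟨γ, by rw [hγ, mul_inv_cancel₀]; simp [hα]⟩
  choose γ hγ using hroot
  set H : (𝓞 K)ˣ → ℝ := fun a => max 1 (house (α * a)⁻¹ * (1 + house β)) with hH
  have hfin : (⋃ a ∈ T, ⋃ σ : K →+* ℂ, ⋃ ζ ∈ nthRootsFinset n (1 : ℂ),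
      (fun η : 𝓞 K => (a : 𝓞 K) * η ^ n) '' {η : 𝓞 K | α * a * η ^ n ≠ 1 ∧
        ∃ u : ℂ, σ η = (γ a σ * ζ) * u ∧ ‖u - 1‖ * house (η : K) ^ M ≤
          C * ‖σ β‖ * H a}).Finite := by
    refine T.finite_toSet.biUnion fun a _ => Set.finite_iUnion fun σ =>
      (nthRootsFinset n (1 : ℂ)).finite_toSet.biUnion fun ζ hζ => Set.Finite.image _ ?_
    refine finite_setOf_approx hd hs hn hM σ ?_ _
    have hζ := (mem_nthRootsFinset (Nat.pos_of_ne_zero hn0) 1).1 hζ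
    rw [mul_pow, hζ, mul_one, hγ]
  refine Set.Finite.of_finite_image (f := fun ε : (𝓞 K)ˣ => (ε : 𝓞 K)) (hfin.subset ?_)
    Units.val_injective.injOn
  rintro _ ⟨ε₁, ⟨ε₂, hε⟩, rfl⟩
  obtain ⟨a, ha, η, rfl⟩ := hT ε₁
  obtain ⟨σ, hσ⟩ := exists_norm_unit_pow_mul_house_le_one ε₂
  have hγ0 : γ a σ ≠ 0 := by
    intro h
    have := hγ a σ
    rw [h, zero_pow hn0, mul_zero] at this
    exact zero_ne_one this
  have hε' : α * a * (η : 𝓞 K) ^ n = 1 - β * ε₂ := by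
    rw [← hε]
    push_cast
    ring
  have hw : (σ (η : 𝓞 K) / γ a σ) ^ n = σ (α * a * (η : 𝓞 K) ^ n) := by
    rw [div_pow, div_eq_iff (pow_ne_zero n hγ0), map_mul σ (α * a), mul_right_comm, hγ, one_mul,
      map_pow]
  obtain ⟨ζ, hζ, hwζ⟩ := hC (σ (η : 𝓞 K) / γ a σ)
  have hζ0 : ζ ≠ 0 := by
    rintro rfl
    rw [zero_pow hn0] at hζ
    exact zero_ne_one hζ
  have hζ1 : ‖ζ‖ = 1 := Complex.norm_eq_one_of_pow_eq_one hζ hn0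
  have hne : α * a * (η : 𝓞 K) ^ n ≠ 1 := by
    rw [hε', Ne, sub_eq_self]
    simp [hβ]
  simp only [Set.mem_iUnion, Set.mem_image, Set.mem_ofPred_eq]
  refine ⟨a, ha, σ, ζ, (mem_nthRootsFinset (Nat.pos_of_ne_zero hn0) 1).2 hζ, (η : 𝓞 K),
    ⟨by exact_mod_cast hne, σ (η : 𝓞 K) / γ a σ / ζ, by field_simp, ?_⟩, by simp⟩
  have hu : ‖σ (η : 𝓞 K) / γ a σ / ζ - 1‖ ≤ C * ‖σ β‖ * ‖σ (ε₂ : 𝓞 K)‖ := by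
    rw [div_sub_one hζ0, norm_div, hζ1, div_one]
    refine hwζ.trans_eq ?_
    rw [hw, hε', map_sub, map_one, sub_sub_cancel_left, norm_neg, map_mul, norm_mul, mul_assoc]
  have hX2 : 1 ≤ house ((ε₂ : 𝓞 K) : K) :=
    one_le_house_of_isIntegral (RingOfIntegers.isIntegral_coe _) (by simp)
  have hη : house ((η : 𝓞 K) : K) ^ n ≤ H a * house ((ε₂ : 𝓞 K) : K) := by
    have e : ((η : 𝓞 K) : K) ^ n = (α * a)⁻¹ * (1 + ((-1 : ℤ) : K) * (β * ε₂)) := by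
      have h0 : α * ((a : 𝓞 K) : K) ≠ 0 := by simp [hα]
      rw [eq_inv_mul_iff_mul_eq₀ h0, hε']
      push_cast
      ring
    rw [← house_pow_eq, e]
    calc house ((α * a)⁻¹ * (1 + ((-1 : ℤ) : K) * (β * ε₂)))
        ≤ house (α * a)⁻¹ * (1 + house β * house ((ε₂ : 𝓞 K) : K)) := by
          refine (house_mul_le _ _).trans (mul_le_mul_of_nonneg_left ?_ (house_nonneg _))
          refine (house_add_le _ _).trans (add_le_add ?_ ?_)
          · have := house_intCast (K := K) 1
            simp at this
            exact this.le
          · refine (house_mul_le _ _).trans ?_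
            rw [house_intCast]
            simpa using house_mul_le β ((ε₂ : 𝓞 K) : K)
      _ ≤ house (α * a)⁻¹ * ((1 + house β) * house ((ε₂ : 𝓞 K) : K)) := by
          refine mul_le_mul_of_nonneg_left ?_ (house_nonneg _)
          linarith
      _ ≤ _ := by
          rw [← mul_assoc]
          exact mul_le_mul_of_nonneg_right (le_max_right _ _) (by linarith)
  have hH1 : 1 ≤ H a := le_max_left _ _
  have hprod : ‖σ (ε₂ : 𝓞 K)‖ * house ((η : 𝓞 K) : K) ^ M ≤ H a := by
    by_contra! hlt
    have h1 : (‖σ (ε₂ : 𝓞 K)‖ * house ((η : 𝓞 K) : K) ^ M) ^ d ≤ H a := by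
      rw [mul_pow, ← pow_mul, ← hnM]
      calc _ ≤ ‖σ (ε₂ : 𝓞 K)‖ ^ d * (H a * house ((ε₂ : 𝓞 K) : K)) := by gcongr
        _ = H a * (‖σ (ε₂ : 𝓞 K)‖ ^ d * house ((ε₂ : 𝓞 K) : K)) := by ring
        _ ≤ H a * 1 := by
          rw [hd] at hσ
          gcongr
        _ = H a := mul_one _
    exact absurd (hlt.trans_le (le_self_pow₀ (hH1.trans hlt.le) (by omega))) (not_lt.2 h1)
  calc _ ≤ C * ‖σ β‖ * ‖σ (ε₂ : 𝓞 K)‖ * house ((η : 𝓞 K) : K) ^ M :=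
        mul_le_mul_of_nonneg_right hu (pow_nonneg (house_nonneg _) _)
    _ = C * ‖σ β‖ * (‖σ (ε₂ : 𝓞 K)‖ * house ((η : 𝓞 K) : K) ^ M) := by ring
    _ ≤ _ := by gcongr

/-- If `y g = C k²` and `y`, `g` generate an ideal containing a fixed `e ≠ 0`, then `y` lies in one
of finitely many square classes. -/
theorem exists_finset_square_reps {C e : 𝓞 K} (hC : C ≠ 0) (he : e ≠ 0) :
    ∃ T : Finset (𝓞 K), ∀ y g k : 𝓞 K, y ≠ 0 → g ≠ 0 → y * g = C * k ^ 2 →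
      e ∈ Ideal.span {y, g} → ∃ a ∈ T, ∃ u v : 𝓞 K, u ≠ 0 ∧ u ^ 2 * y = a * v ^ 2 := by
  classical
  obtain ⟨S, hS⟩ := exists_ideal_eq_prod_mul_sq hC he
  obtain ⟨U, hU⟩ := exists_finset_unit_reps (K := K) two_ne_zero
  let Y : Set (𝓞 K) := {y | y ≠ 0 ∧ ∃ O ⊆ S, ∃ J : Ideal (𝓞 K), J ≠ 0 ∧
    Ideal.span {y} = (∏ P ∈ O, P) * J ^ 2}
  have hY : ∀ y : Y, ∃ O ⊆ S, ∃ J : Ideal (𝓞 K), J ≠ 0 ∧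
    Ideal.span {(y : 𝓞 K)} = (∏ P ∈ O, P) * J ^ 2 := fun y => y.2.2
  choose O hO J hJ hOJ using hY
  let c : Y → S.powerset × ClassGroup (𝓞 K) := fun y =>
    (⟨O y, mem_powerset.2 (hO y)⟩,
      ClassGroup.mk0 ⟨J y, mem_nonZeroDivisors_of_ne_zero (hJ y)⟩)
  have : Fintype (Set.range c) := Fintype.ofFinite _
  refine ⟨(U ×ˢ univ).image fun p : (𝓞 K)ˣ × Set.range c =>
    (p.1 : 𝓞 K) * ((Set.rangeSplitting c p.2 : Y) : 𝓞 K), fun y g k hy hg h h' => ?_⟩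
  let y₁ : Y := ⟨y, hy, hS y g k hy hg h h'⟩
  obtain ⟨z, hz⟩ : ∃ z : Set.range c, z = ⟨c y₁, y₁, rfl⟩ := ⟨_, rfl⟩
  obtain ⟨y₀, hy₀⟩ : ∃ y₀, y₀ = Set.rangeSplitting c z := ⟨_, rfl⟩
  have hc : c y₁ = c y₀ := by rw [hy₀, Set.apply_rangeSplitting c, hz]
  have hc1 : O y₁ = O y₀ := congrArg (fun p => (p.1 : Finset (Ideal (𝓞 K)))) hc
  have hc2 := congrArg Prod.snd hc
  obtain ⟨u, v, hu, hv, huv⟩ := ClassGroup.mk0_eq_mk0_iff.1 hc2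
  have hspan : Ideal.span {u ^ 2 * y} = Ideal.span {v ^ 2 * (y₀ : 𝓞 K)} := by
    rw [← Ideal.span_singleton_mul_span_singleton, ← Ideal.span_singleton_mul_span_singleton,
      ← Ideal.span_singleton_pow, ← Ideal.span_singleton_pow, show y = (y₁ : 𝓞 K) from rfl,
      hOJ, hOJ, hc1, mul_left_comm, ← mul_pow, mul_left_comm, ← mul_pow]
    exact congrArg (fun I => (∏ P ∈ O y₀, P) * I ^ 2) huv
  obtain ⟨ε, hε⟩ := Ideal.span_singleton_eq_span_singleton.1 hspan.symm
  obtain ⟨a, ha, η, rfl⟩ := hU ε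
  refine ⟨a * y₀, mem_image.2 ⟨(a, z), mem_product.2 ⟨ha, mem_univ _⟩, by rw [hy₀]⟩,
    u, v * η, hu, ?_⟩
  rw [← hε]
  push_cast
  ring

/-- A nonzero algebraic integer has finitely many divisors up to units. -/
theorem exists_finset_divisor_reps {d : 𝓞 K} (hd : d ≠ 0) :
    ∃ A : Finset (𝓞 K), ∀ x, x ∣ d → ∃ a ∈ A, ∃ ε : (𝓞 K)ˣ, x = a * ε := by
  classical
  have : Fintype {I : Ideal (𝓞 K) // I ∣ Ideal.span {d}} :=
    UniqueFactorizationMonoid.fintypeSubtypeDvd _ (by simpa using hd)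
  let c : {x : 𝓞 K // x ∣ d} → {I : Ideal (𝓞 K) // I ∣ Ideal.span {d}} := fun x =>
    ⟨Ideal.span {(x : 𝓞 K)}, Ideal.dvd_iff_le.2 (Ideal.span_singleton_le_span_singleton.2 x.2)⟩
  have : Fintype (Set.range c) := Fintype.ofFinite _
  refine ⟨univ.image fun z : Set.range c => ((Set.rangeSplitting c z : {x : 𝓞 K // x ∣ d}) : 𝓞 K),
    fun x hx => ⟨_, mem_image_of_mem _ (mem_univ ⟨c ⟨x, hx⟩, ⟨x, hx⟩, rfl⟩), ?_⟩⟩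
  have h := congrArg Subtype.val
    (Set.apply_rangeSplitting c ⟨c ⟨x, hx⟩, ⟨x, hx⟩, rfl⟩)
  obtain ⟨ε, hε⟩ := Ideal.span_singleton_eq_span_singleton.1 h
  exact ⟨ε, hε.symm⟩

/-- Ratios of triples of divisors of a fixed `d ≠ 0` with sum zero take finitely many values. -/
theorem finite_ratio_of_add_eq_zero {d : 𝓞 K} (hd : d ≠ 0) :
    {q : K | ∃ x y z : 𝓞 K, x ∣ d ∧ y ∣ d ∧ z ∣ d ∧ x + y + z = 0 ∧ q = x / z}.Finite := by
  obtain ⟨A, hA⟩ := exists_finset_divisor_reps hd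
  refine Set.Finite.subset (s := ⋃ a ∈ A, ⋃ b ∈ A, ⋃ c ∈ A,
    {q : K | a ≠ 0 ∧ b ≠ 0 ∧ c ≠ 0 ∧ ∃ ε₁ ε₂ : (𝓞 K)ˣ,
      (-a / c : K) * ε₁ + (-b / c : K) * ε₂ = 1 ∧ q = a / c * ε₁}) ?_ ?_
  · refine A.finite_toSet.biUnion fun a _ => A.finite_toSet.biUnion fun b _ =>
      A.finite_toSet.biUnion fun c _ => ?_
    by_cases h : a ≠ 0 ∧ b ≠ 0 ∧ c ≠ 0
    · have h1 : (-a / c : K) ≠ 0 := by simp [h.1, h.2.2]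
      have h2 : (-b / c : K) ≠ 0 := by simp [h.2.1, h.2.2]
      refine ((finite_unit_equation_fst h1 h2).image fun ε : (𝓞 K)ˣ =>
        (a / c * (ε : 𝓞 K) : K)).subset ?_
      rintro q ⟨-, -, -, ε₁, ε₂, h3, rfl⟩
      exact ⟨ε₁, ⟨ε₂, h3⟩, rfl⟩
    · refine Set.finite_empty.subset ?_
      rintro q ⟨ha, hb, hc, -⟩
      exact h ⟨ha, hb, hc⟩
  · rintro q ⟨x, y, z, hx, hy, hz, hxyz, rfl⟩
    obtain ⟨a, ha, ε₁, rfl⟩ := hA x hx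
    obtain ⟨b, hb, ε₂, rfl⟩ := hA y hy
    obtain ⟨c, hc, ε₃, rfl⟩ := hA z hz
    have ha0 : a ≠ 0 := by rintro rfl; simp [hd] at hx
    have hb0 : b ≠ 0 := by rintro rfl; simp [hd] at hy
    have hc0 : c ≠ 0 := by rintro rfl; simp [hd] at hz
    simp only [Set.mem_iUnion]
    refine ⟨a, ha, b, hb, c, hc, ha0, hb0, hc0, ε₁ * ε₃⁻¹, ε₂ * ε₃⁻¹, ?_, ?_⟩
    all_goals
      have hc' : (c : K) ≠ 0 := by simpa using hc0
      have h3 : ((ε₃ : 𝓞 K) : K) * ((ε₃⁻¹ : (𝓞 K)ˣ) : 𝓞 K) = 1 := by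
        rw [← map_mul, Units.mul_inv, map_one]
      simp only [RingOfIntegers.coe_eq_algebraMap] at h3 hc' ⊢
      have h3' := left_ne_zero_of_mul_eq_one h3
      have hx' := congrArg (algebraMap (𝓞 K) K) hxyz
      simp only [map_add, map_mul, map_zero, Units.val_mul] at hx' ⊢
      rw [eq_inv_of_mul_eq_one_right h3]
      field_simp
    linear_combination -hx'

/-- There are finitely many `x ∈ 𝓞 K` such that `x - a₁`, `x - a₂` and `x - a₃` are all squares. -/
theorem finite_setOf_three_squares {a₁ a₂ a₃ : 𝓞 K} (h₁₂ : a₁ ≠ a₂) (h₁₃ : a₁ ≠ a₃)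
    (h₂₃ : a₂ ≠ a₃) :
    {x : 𝓞 K | (∃ w, w ^ 2 = x - a₁) ∧ (∃ w, w ^ 2 = x - a₂) ∧ ∃ w, w ^ 2 = x - a₃}.Finite := by
  obtain ⟨d, hd⟩ : ∃ d, d = (a₂ - a₁) * (a₃ - a₂) * (a₃ - a₁) := ⟨_, rfl⟩
  have hd0 : d ≠ 0 := by
    rw [hd]
    exact mul_ne_zero (mul_ne_zero (sub_ne_zero.2 h₁₂.symm) (sub_ne_zero.2 h₂₃.symm))
      (sub_ne_zero.2 h₁₃.symm)
  have hQ := finite_ratio_of_add_eq_zero hd0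
  refine Set.Finite.of_finite_image (f := algebraMap (𝓞 K) K) ?_
    (FaithfulSMul.algebraMap_injective (𝓞 K) K).injOn
  refine ((hQ.prod hQ).image fun q : K × K =>
    ((a₁ - a₃) * (-q.1 / q.2) + (a₁ - a₃) / (-q.1 / q.2) - 2 * (a₁ - a₃)) / 4 + a₁).subset ?_
  rintro _ ⟨x, ⟨⟨w₁, h1⟩, ⟨w₂, h2⟩, ⟨w₃, h3⟩⟩, rfl⟩
  have e12 : (w₁ - w₂) * (w₁ + w₂) = a₂ - a₁ := by linear_combination h1 - h2
  have e23 : (w₂ - w₃) * (w₂ + w₃) = a₃ - a₂ := by linear_combination h2 - h3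
  have e31 : (w₁ - w₃) * (w₁ + w₃) = a₃ - a₁ := by linear_combination h1 - h3
  have d12 : w₁ - w₂ ∣ d := ⟨(w₁ + w₂) * (a₃ - a₂) * (a₃ - a₁), by rw [hd, ← e12]; ring⟩
  have d23 : w₂ - w₃ ∣ d := ⟨(w₂ + w₃) * (a₂ - a₁) * (a₃ - a₁), by rw [hd, ← e23]; ring⟩
  have d23' : w₂ + w₃ ∣ d := ⟨(w₂ - w₃) * (a₂ - a₁) * (a₃ - a₁), by rw [hd, ← e23]; ring⟩
  have d31 : w₃ - w₁ ∣ d := ⟨-(w₁ + w₃) * (a₂ - a₁) * (a₃ - a₂), by rw [hd, ← e31]; ring⟩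
  have d31' : -(w₁ + w₃) ∣ d := ⟨-(w₁ - w₃) * (a₂ - a₁) * (a₃ - a₂), by rw [hd, ← e31]; ring⟩
  refine ⟨(((w₁ - w₂ : 𝓞 K) : K) / (-(w₁ + w₃) : 𝓞 K), ((w₁ - w₂ : 𝓞 K) : K) / (w₃ - w₁ : 𝓞 K)),
    ⟨⟨_, _, _, d12, d23', d31', by ring, rfl⟩, ⟨_, _, _, d12, d23, d31, by ring, rfl⟩⟩, ?_⟩
  have hne : ∀ {y : 𝓞 K}, y ∣ d → algebraMap (𝓞 K) K y ≠ 0 := fun {y} hy h0 => by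
    rw [map_eq_zero_iff _ (FaithfulSMul.algebraMap_injective (𝓞 K) K)] at h0
    exact hd0 (zero_dvd_iff.1 (h0 ▸ hy))
  have n12 := hne d12
  have n31 := hne d31
  have n31' := hne d31'
  have E31 := congrArg (algebraMap (𝓞 K) K) e31
  have E1 := congrArg (algebraMap (𝓞 K) K) h1
  simp only [map_sub, map_add, map_mul, map_neg, map_pow] at n12 n31 n31' E31 E1 ⊢
  have n31'' := neg_ne_zero.1 n31'
  have hr : -((algebraMap (𝓞 K) K w₁ - algebraMap (𝓞 K) K w₂) /
      -(algebraMap (𝓞 K) K w₁ + algebraMap (𝓞 K) K w₃)) /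
      ((algebraMap (𝓞 K) K w₁ - algebraMap (𝓞 K) K w₂) /
      (algebraMap (𝓞 K) K w₃ - algebraMap (𝓞 K) K w₁)) =
      (algebraMap (𝓞 K) K w₃ - algebraMap (𝓞 K) K w₁) /
      (algebraMap (𝓞 K) K w₁ + algebraMap (𝓞 K) K w₃) := by
    field_simp
  rw [hr, show algebraMap (𝓞 K) K a₁ - algebraMap (𝓞 K) K a₃ =
    (algebraMap (𝓞 K) K w₃ - algebraMap (𝓞 K) K w₁) *
    (algebraMap (𝓞 K) K w₁ + algebraMap (𝓞 K) K w₃) by linear_combination E31]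
  field_simp
  linear_combination 4 * E1

/-- There are finitely many `x ∈ 𝓞 K` such that `x - a₁`, `x - a₂` and `x - a₃` all lie in a fixed
finite union of square classes. -/
theorem finite_setOf_square_classes {a₁ a₂ a₃ : 𝓞 K} (h₁₂ : a₁ ≠ a₂) (h₁₃ : a₁ ≠ a₃)
    (h₂₃ : a₂ ≠ a₃) (T : Finset (𝓞 K)) :
    {x : 𝓞 K | ∀ a ∈ ({a₁, a₂, a₃} : Set (𝓞 K)),
      ∃ t ∈ T, ∃ u v : 𝓞 K, u ≠ 0 ∧ u ^ 2 * (x - a) = t * v ^ 2}.Finite := by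
  let p : K[X] := ∏ t ∈ T, (X ^ 2 - C (t : K))
  let L := p.SplittingField
  have : CharZero L := charZero_of_injective_algebraMap (algebraMap K L).injective
  have : FiniteDimensional ℚ L := Module.Finite.trans K L
  have : NumberField L := ⟨⟩
  have hp : p ≠ 0 := prod_ne_zero_iff.2 fun t _ => X_pow_sub_C_ne_zero two_pos _
  have hsqrt : ∀ t ∈ T, ∃ s : L, s ^ 2 = algebraMap (𝓞 K) L t := by
    intro t ht
    have hs := (SplittingField.splits p).of_dvd (map_ne_zero hp)
      (Polynomial.map_dvd (algebraMap K L) (dvd_prod_of_mem _ ht))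
    obtain ⟨s, hs⟩ := hs.exists_eval_eq_zero (by
      rw [degree_map, degree_X_pow_sub_C two_pos]
      decide)
    refine ⟨s, ?_⟩
    rw [eval_map_algebraMap] at hs
    rw [aeval_sub, aeval_X_pow, aeval_C, sub_eq_zero] at hs
    exact hs
  have hinj : Function.Injective (algebraMap (𝓞 K) (𝓞 L)) :=
    FaithfulSMul.algebraMap_injective _ _
  refine Set.Finite.of_finite_image (f := algebraMap (𝓞 K) (𝓞 L)) ?_ hinj.injOn
  refine (finite_setOf_three_squares (hinj.ne h₁₂) (hinj.ne h₁₃) (hinj.ne h₂₃)).subset ?_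
  rintro _ ⟨x, hx, rfl⟩
  have key : ∀ a ∈ ({a₁, a₂, a₃} : Set (𝓞 K)), ∃ w : 𝓞 L,
      w ^ 2 = algebraMap (𝓞 K) (𝓞 L) x - algebraMap (𝓞 K) (𝓞 L) a := by
    intro a ha
    obtain ⟨t, ht, u, v, hu, huv⟩ := hx a ha
    obtain ⟨s, hs⟩ := hsqrt t ht
    have hu' : algebraMap (𝓞 K) L u ≠ 0 := by
      rwa [Ne, map_eq_zero_iff _ (FaithfulSMul.algebraMap_injective (𝓞 K) L)]
    have hw : (s * algebraMap (𝓞 K) L v / algebraMap (𝓞 K) L u) ^ 2 =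
        algebraMap (𝓞 L) L (algebraMap (𝓞 K) (𝓞 L) (x - a)) := by
      rw [← IsScalarTower.algebraMap_apply, div_pow, mul_pow, hs, div_eq_iff (pow_ne_zero 2 hu'),
        ← map_pow, ← map_pow, ← map_mul, ← map_mul, ← huv, mul_comm]
    have hintegral : IsIntegral ℤ (s * algebraMap (𝓞 K) L v / algebraMap (𝓞 K) L u) :=
      IsIntegral.of_pow two_pos (hw ▸ RingOfIntegers.isIntegral_coe _)
    refine ⟨⟨_, hintegral⟩, RingOfIntegers.ext ?_⟩
    rw [← map_sub]
    exact hw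
  exact ⟨key _ (by simp), key _ (by simp), key _ (by simp)⟩

/-- If `f n` is a nonzero square and `α` is a simple root of `f` with leading coefficient `c`, then
`c n - c α` lies in one of finitely many square classes. -/
theorem exists_square_reps_of_root {f : ℤ[X]} (hf : 1 ≤ f.natDegree) {α : K}
    (hα : f.aeval α = 0) (hα' : f.derivative.aeval α ≠ 0) :
    ∃ a : 𝓞 K, (a : K) = f.leadingCoeff * α ∧ ∃ T : Finset (𝓞 K), ∀ n k : ℤ,
      f.eval n = k ^ 2 → f.eval n ≠ 0 → ∃ t ∈ T, ∃ u v : 𝓞 K, u ≠ 0 ∧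
        u ^ 2 * ((f.leadingCoeff * n : ℤ) - a) = t * v ^ 2 := by
  have hf0 : f.leadingCoeff ≠ 0 := by
    rw [Ne, leadingCoeff_eq_zero]
    rintro rfl
    simp at hf
  have hintegral : IsIntegral ℤ ((f.leadingCoeff : K) * α) := by
    simpa [Algebra.smul_def] using isIntegral_leadingCoeff_smul f α hα
  obtain ⟨F, hF⟩ : ∃ F, F = f.integralNormalization := ⟨_, rfl⟩
  have hcomp : F.comp (C f.leadingCoeff * X) = C (f.leadingCoeff ^ (f.natDegree - 1)) * f := by
    have := integralNormalization_eval₂_leadingCoeff_mul hf (C : ℤ →+* ℤ[X]) X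
    rwa [eval₂_C_X, ← C_pow, ← hF] at this
  let a : 𝓞 K := ⟨_, hintegral⟩
  have ha : (a : K) = f.leadingCoeff * α := rfl
  have hmap : ∀ G : ℤ[X],
      algebraMap (𝓞 K) K (G.aeval a) = (G.comp (C f.leadingCoeff * X)).aeval α := by
    intro G
    rw [aeval_comp, ← aeval_algebraMap_apply]
    simp [ha]
  have hroot : F.aeval a = 0 := by
    apply FaithfulSMul.algebraMap_injective (𝓞 K) K
    rw [hmap, hcomp]
    simp [hα]
  have hder : F.derivative.aeval a ≠ 0 := by
    intro h0
    have h := congrArg (fun p => p.derivative.aeval α) hcomp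
    simp only [derivative_comp, derivative_C_mul, map_mul, ← hmap, h0, map_zero, mul_zero] at h
    rw [aeval_C] at h
    exact mul_ne_zero (by simpa using pow_ne_zero _ hf0) hα' h.symm
  obtain ⟨G, hG⟩ := dvd_iff_isRoot.2 (show (F.map (algebraMap ℤ (𝓞 K))).IsRoot a by
    rw [IsRoot, eval_map_algebraMap, hroot])
  have he : G.eval a ≠ 0 := by
    intro h0
    apply hder
    rw [← eval_map_algebraMap, ← derivative_map, hG]
    simp [h0]
  obtain ⟨T, hT⟩ := exists_finset_square_reps (K := K)
    (C := ((f.leadingCoeff ^ (f.natDegree - 1) : ℤ) : 𝓞 K))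
    (by exact_mod_cast pow_ne_zero _ hf0) he
  refine ⟨a, ha, T, fun n k hk hn => ?_⟩
  have hprod : (((f.leadingCoeff * n : ℤ) : 𝓞 K) - a) * G.eval ((f.leadingCoeff * n : ℤ) : 𝓞 K) =
      (f.leadingCoeff ^ (f.natDegree - 1) : ℤ) * (k : 𝓞 K) ^ 2 := by
    have h1 := congrArg (eval ((f.leadingCoeff * n : ℤ) : 𝓞 K)) hG
    have h2 := congrArg (eval n) hcomp
    simp only [eval_comp, eval_mul, eval_C, eval_X, hk] at h2
    rw [eval_intCast_map, Int.cast_id, h2] at h1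
    simpa using h1.symm
  have hne : (((f.leadingCoeff * n : ℤ) : 𝓞 K) - a) *
      G.eval ((f.leadingCoeff * n : ℤ) : 𝓞 K) ≠ 0 := by
    rw [hprod]
    have : f.leadingCoeff ^ (f.natDegree - 1) * k ^ 2 ≠ 0 :=
      mul_ne_zero (pow_ne_zero _ hf0) (hk ▸ hn)
    exact_mod_cast this
  refine hT _ _ k (left_ne_zero_of_mul hne) (right_ne_zero_of_mul hne) hprod ?_
  obtain ⟨q, hq⟩ := sub_dvd_eval_sub ((f.leadingCoeff * n : ℤ) : 𝓞 K) a G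
  exact Ideal.mem_span_pair.2 ⟨-q, 1, by linear_combination hq⟩

end NumberField

end

/-- If `f ∈ ℤ[x]` is squarefree of degree at least `3`, then `f` takes square values only
finitely often. -/
theorem square_values_finite_of_squarefree (f : Polynomial ℤ) (hf : Squarefree f)
    (hdeg : 3 ≤ f.natDegree) :
    {n : ℤ | ∃ k : ℤ, f.eval n = k ^ 2}.Finite := by
  classical
  obtain ⟨g, hg⟩ : ∃ g, g = f.map (Int.castRingHom ℚ) := ⟨_, rfl⟩
  have hsep : g.Separable := PerfectField.separable_iff_squarefree.2 <|
    hg ▸ squarefree_map_castRingHom hf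
  have : NumberField g.SplittingField :=
    { to_charZero := inferInstance
      to_finiteDimensional := by
        convert (inferInstance : FiniteDimensional ℚ g.SplittingField) }
  have hcard := card_rootSet_eq_natDegree hsep (SplittingField.splits g)
  rw [hg, natDegree_map_eq_of_injective Int.cast_injective, ← hg] at hcard
  obtain ⟨⟨α₁, h₁⟩, ⟨α₂, h₂⟩, ⟨α₃, h₃⟩, h₁₂, h₁₃, h₂₃⟩ :=
    Fintype.two_lt_card_iff.1 (hcard.symm ▸ hdeg : 2 < Fintype.card _)
  have hroot : ∀ α ∈ g.rootSet g.SplittingField,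
      f.aeval α = 0 ∧ f.derivative.aeval α ≠ 0 := by
    intro α hα
    have h0 := (mem_rootSet.1 hα).2
    refine ⟨?_, fun h => hsep.aeval_derivative_ne_zero h0 ?_⟩
    · rwa [congrArg (aeval α) hg, ← algebraMap_int_eq, aeval_map_algebraMap] at h0
    · rwa [congrArg (fun q => aeval α (derivative q)) hg, derivative_map, ← algebraMap_int_eq,
        aeval_map_algebraMap]
  have hc : f.leadingCoeff ≠ 0 := leadingCoeff_ne_zero.2 hf.ne_zero
  obtain ⟨a₁, ha₁, T₁, hT₁⟩ := exists_square_reps_of_root (by omega) (hroot _ h₁).1 (hroot _ h₁).2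
  obtain ⟨a₂, ha₂, T₂, hT₂⟩ := exists_square_reps_of_root (by omega) (hroot _ h₂).1 (hroot _ h₂).2
  obtain ⟨a₃, ha₃, T₃, hT₃⟩ := exists_square_reps_of_root (by omega) (hroot _ h₃).1 (hroot _ h₃).2
  have hne : ∀ {a b : NumberField.RingOfIntegers g.SplittingField} {α β : g.SplittingField}
      {hα : α ∈ g.rootSet g.SplittingField} {hβ : β ∈ g.rootSet g.SplittingField},
      (a : g.SplittingField) = f.leadingCoeff * α →
      (b : g.SplittingField) = f.leadingCoeff * β →
      (⟨α, hα⟩ : g.rootSet g.SplittingField) ≠ ⟨β, hβ⟩ → a ≠ b := by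
    rintro a b α β hα hβ ha hb hαβ rfl
    refine hαβ (Subtype.ext (mul_left_cancel₀ ?_ (ha.symm.trans hb)))
    exact_mod_cast hc
  have hfin := finite_setOf_square_classes (hne ha₁ ha₂ h₁₂) (hne ha₁ ha₃ h₁₃) (hne ha₂ ha₃ h₂₃)
    (T₁ ∪ T₂ ∪ T₃)
  have hinj : Function.Injective fun n : ℤ =>
      ((f.leadingCoeff * n : ℤ) : NumberField.RingOfIntegers g.SplittingField) :=
    fun m n h => mul_left_cancel₀ hc (Int.cast_injective h)
  refine ((hfin.preimage hinj.injOn).union (f.roots.toFinset.finite_toSet)).subset ?_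
  rintro n ⟨k, hk⟩
  by_cases hn : f.eval n = 0
  · exact Or.inr (by simpa [hf.ne_zero] using hn)
  · refine Or.inl ?_
    rintro a (rfl | rfl | rfl)
    · obtain ⟨t, ht, h⟩ := hT₁ n k hk hn
      exact ⟨t, by simp [ht], h⟩
    · obtain ⟨t, ht, h⟩ := hT₂ n k hk hn
      exact ⟨t, by simp [ht], h⟩
    · obtain ⟨t, ht, h⟩ := hT₃ n k hk hn
      exact ⟨t, by simp [ht], h⟩
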